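/- There exists a natural number n₀ such that the following holds. Let X be a finite set with n := |X| ≥ n₀ and let G ≤ Sym(X) be primitive with G ≠ Alt(X). Then there exist a natural number k ≤ n and a nonempty family ℬ of k-element subsets of X such that Aut(X,ℬ) = G and G acts transitively on ℬ, i.e., for all B₁, B₂ ∈ ℬ there is g ∈ G with g(B₁) = B₂. -/

import Mathlib

/-- A subgroup `G ≤ Sym(X)` is primitive if its natural action on `X` is transitive
and every `G`-block is trivial (i.e. the action is preprimitive). -/
def IsPrimitiveSubgroup {X : Type*} (G : Subgroup (Equiv.Perm X)) : Prop :=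
  MulAction.IsPretransitive G X ∧ ∀ B : Set X, MulAction.IsBlock G B → MulAction.IsTrivialBlock B

namespace PrimitiveAut

open Finset

section Counting

/-- The number of sets which are unions of classes of a relation moving all points of `W`. -/
theorem card_respecting_mul_le {X : Type*} [Fintype X] [DecidableEq X] (R : X → X → Prop)
    (W : Finset X) (hW : ∀ x ∈ W, ∃ y, y ≠ x ∧ R x y) (F : Finset (Finset X))
    (hF : ∀ Y ∈ F, ∀ x y, R x y → (x ∈ Y ↔ y ∈ Y)) :
    F.card * 2 ^ (W.card / 2) ≤ 2 ^ Fintype.card X := by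
  classical
  let s : Setoid X := Relation.EqvGen.setoid R
  let r : X → X := fun x => (Quotient.mk s x).out
  have hr : ∀ x, Relation.EqvGen R (r x) x := fun x => Quotient.mk_out (s := s) x
  have hrr : ∀ x y, Relation.EqvGen R x y → r x = r y := fun x y h => by
    have : Quotient.mk s x = Quotient.mk s y := Quotient.sound h
    simp only [r, this]
  have hFE : ∀ Y ∈ F, ∀ x y, Relation.EqvGen R x y → (x ∈ Y ↔ y ∈ Y) := by
    intro Y hY x y h
    induction h with
    | rel x y h => exact hF Y hY x y h
    | refl x => rfl
    | symm x y _ ih => exact ih.symm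
    | trans x y z _ _ ih1 ih2 => exact ih1.trans ih2
  let P : Finset X := univ.filter (fun x => r x = x)
  let N : Finset X := univ.filter (fun x => r x ≠ x)
  have hPN : P.card + N.card = Fintype.card X := by
    simpa using Finset.card_filter_add_card_filter_not (s := (univ : Finset X)) (fun x => r x = x)
  have hWN : W.card ≤ 2 * N.card := by
    have hsub : W ⊆ N ∪ N.image r := by
      intro x hx
      by_cases hxr : r x = x
      · obtain ⟨y, hy, hxy⟩ := hW x hx
        have h1 : r y = x := by rw [← hrr x y (.rel _ _ hxy), hxr]
        refine mem_union_right _ (mem_image.2 ⟨y, ?_, h1⟩)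
        simp only [N, mem_filter, mem_univ, true_and, h1]
        exact hy.symm
      · exact mem_union_left _ (by simp [N, hxr])
    calc W.card ≤ (N ∪ N.image r).card := card_le_card hsub
      _ ≤ N.card + (N.image r).card := card_union_le _ _
      _ ≤ N.card + N.card := Nat.add_le_add_left card_image_le _
      _ = 2 * N.card := by ring
  have hFP : F.card ≤ 2 ^ P.card := by
    rw [← card_powerset P]
    refine card_le_card_of_injOn (t := P.powerset) (fun Y : Finset X => Y ∩ P)
      (fun Y _ => by simp) ?_
    intro Y hY Z hZ h
    have hm : ∀ x, r x ∈ P := fun x => by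
      simp only [P, mem_filter, mem_univ, true_and]
      exact hrr _ _ (hr x)
    ext x
    rw [← hFE Y hY _ _ (hr x), ← hFE Z hZ _ _ (hr x)]
    have := congrArg (fun S : Finset X => r x ∈ S) h
    simpa [hm x] using this
  calc F.card * 2 ^ (W.card / 2) ≤ 2 ^ P.card * 2 ^ N.card := by
        gcongr
        · norm_num
        · omega
    _ = 2 ^ Fintype.card X := by rw [← pow_add, hPN]

theorem card_relative_mul_le {X : Type*} [Fintype X] [DecidableEq X] (R : X → X → Prop)
    (W : Finset X) (hW : ∀ x ∈ W, ∃ y, y ≠ x ∧ R x y) (c : X → X → Prop)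
    (F : Finset (Finset X))
    (hF : ∀ Y ∈ F, ∀ x y, R x y → ((x ∈ Y ↔ y ∈ Y) ↔ c x y)) :
    F.card * 2 ^ (W.card / 2) ≤ 2 ^ Fintype.card X := by
  rcases F.eq_empty_or_nonempty with rfl | ⟨Z, hZ⟩
  · simp
  have hinj : Function.Injective (fun Y : Finset X => symmDiff Y Z) :=
    symmDiff_left_injective Z
  rw [← card_image_of_injective F hinj]
  refine card_respecting_mul_le R W hW _ fun Y hY x y hxy => ?_
  obtain ⟨Y', hY', rfl⟩ := mem_image.1 hY
  have h1 := hF Y' hY' x y hxy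
  have h2 := hF Z hZ x y hxy
  simp only [mem_symmDiff]
  tauto

theorem card_le_of_relative_union {X D : Type*} [Fintype X] [DecidableEq X]
    (𝒟 : Finset D) (R c : D → X → X → Prop) (w : ℕ)
    (hR : ∀ δ ∈ 𝒟, ∃ W : Finset X, w ≤ W.card ∧ ∀ x ∈ W, ∃ y, y ≠ x ∧ R δ x y)
    (F : Finset (Finset X))
    (hF : ∀ Y ∈ F, ∃ δ ∈ 𝒟, ∀ x y, R δ x y → ((x ∈ Y ↔ y ∈ Y) ↔ c δ x y)) :
    F.card * 2 ^ (w / 2) ≤ 𝒟.card * 2 ^ Fintype.card X := by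
  classical
  let Fd : D → Finset (Finset X) := fun δ =>
    univ.filter (fun Y => ∀ x y, R δ x y → ((x ∈ Y ↔ y ∈ Y) ↔ c δ x y))
  have hsub : F ⊆ 𝒟.biUnion Fd := by
    intro Y hY
    obtain ⟨δ, hδ, h⟩ := hF Y hY
    exact mem_biUnion.2 ⟨δ, hδ, by simpa [Fd] using h⟩
  calc F.card * 2 ^ (w / 2) ≤ (∑ δ ∈ 𝒟, (Fd δ).card) * 2 ^ (w / 2) := by
        gcongr; exact (card_le_card hsub).trans card_biUnion_le
    _ = ∑ δ ∈ 𝒟, (Fd δ).card * 2 ^ (w / 2) := by rw [sum_mul]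
    _ ≤ ∑ δ ∈ 𝒟, 2 ^ Fintype.card X := by
        refine sum_le_sum fun δ hδ => ?_
        obtain ⟨W, hw, hW⟩ := hR δ hδ
        refine le_trans ?_ (card_relative_mul_le (R δ) W hW (c δ) (Fd δ) (fun Y hY => ?_))
        · gcongr
          norm_num
        · simpa [Fd] using hY
    _ = _ := by simp

theorem card_le_of_respecting_union {X D : Type*} [Fintype X] [DecidableEq X]
    (𝒟 : Finset D) (R : D → X → X → Prop) (w : ℕ)
    (hR : ∀ δ ∈ 𝒟, ∃ W : Finset X, w ≤ W.card ∧ ∀ x ∈ W, ∃ y, y ≠ x ∧ R δ x y)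
    (F : Finset (Finset X))
    (hF : ∀ Y ∈ F, ∃ δ ∈ 𝒟, ∀ x y, R δ x y → (x ∈ Y ↔ y ∈ Y)) :
    F.card * 2 ^ (w / 2) ≤ 𝒟.card * 2 ^ Fintype.card X :=
  card_le_of_relative_union 𝒟 R (fun _ _ _ => True) w hR F (by simpa using hF)

/-- Size of Hamming balls. -/
theorem card_hamming_ball_le {ι X : Type*} [Fintype ι] [Fintype X] [DecidableEq ι] [DecidableEq X]
    [Nonempty ι] (f : ι → X) (t : ℕ) :
    (univ.filter (fun b : ι → X => (univ.filter (fun j => b j ≠ f j)).card ≤ t)).card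
      ≤ (Fintype.card ι * Fintype.card X) ^ t := by
  induction t with
  | zero =>
    rw [pow_zero, card_le_one]
    have key : ∀ b : ι → X, (univ.filter (fun j => b j ≠ f j)).card ≤ 0 → b = f := by
      intro b hb
      funext j
      by_contra hj
      have : j ∈ univ.filter (fun j => b j ≠ f j) := by simpa using hj
      have := card_pos.2 ⟨j, this⟩
      omega
    intro b hb c hc
    simp only [mem_filter, mem_univ, true_and] at hb hc
    rw [key b hb, key c hc]
  | succ t ih =>
    set B := univ.filter (fun b : ι → X => (univ.filter (fun j => b j ≠ f j)).card ≤ t) with hB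
    have hsub : univ.filter (fun b : ι → X => (univ.filter (fun j => b j ≠ f j)).card ≤ t + 1)
        ⊆ (B ×ˢ (univ : Finset (ι × X))).image (fun q => Function.update q.1 q.2.1 q.2.2) := by
      intro b hb
      simp only [mem_filter, mem_univ, true_and] at hb
      obtain ⟨j, hj⟩ : ∃ j, b = f ∨ b j ≠ f j := by
        by_cases h : b = f
        · exact ⟨Classical.arbitrary ι, .inl h⟩
        · obtain ⟨j, hj⟩ := Function.ne_iff.1 h
          exact ⟨j, .inr hj⟩
      refine mem_image.2 ⟨(Function.update b j (f j), j, b j), ?_, by simp⟩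
      simp only [mem_product, mem_univ, and_true, hB, mem_filter, true_and]
      rcases hj with rfl | hj
      · simp
      · have : univ.filter (fun i => Function.update b j (f j) i ≠ f i)
            ⊆ (univ.filter (fun j => b j ≠ f j)).erase j := by
          intro i hi
          simp only [mem_filter, mem_univ, true_and, mem_erase] at hi ⊢
          by_cases hij : i = j
          · subst hij; simp at hi
          · rw [Function.update_of_ne hij] at hi; exact ⟨hij, hi⟩
        have h2 := card_le_card this
        rw [card_erase_of_mem (by simpa using hj)] at h2
        omega
    calc _ ≤ _ := card_le_card hsub
      _ ≤ _ := card_image_le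
      _ = B.card * (Fintype.card ι * Fintype.card X) := by simp
      _ ≤ _ := by rw [pow_succ]; gcongr

theorem card_perm_near_le {X : Type*} [Fintype X] [DecidableEq X] [Nonempty X]
    (f : X → X) (t : ℕ) (F : Finset (Equiv.Perm X))
    (hF : ∀ h ∈ F, (univ.filter (fun x => h x ≠ f x)).card ≤ t) :
    F.card ≤ (Fintype.card X ^ 2) ^ t := by
  rw [sq]
  refine le_trans ?_ (card_hamming_ball_le f t)
  refine card_le_card_of_injOn (fun h => (h : X → X)) (fun h hh => ?_) ?_
  · simpa using hF h hh
  · intro a _ b _ h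
    exact DFunLike.coe_injective h

theorem card_finset_le_of_card_le {X : Type*} [Fintype X] [DecidableEq X] [Nonempty X]
    (k : ℕ) (F : Finset (Finset X)) (hF : ∀ E ∈ F, E.card ≤ k) :
    F.card ≤ (2 * Fintype.card X) ^ k := by
  have h := card_hamming_ball_le (ι := X) (X := Bool) (fun _ => false) k
  rw [mul_comm, Fintype.card_bool] at h
  refine le_trans ?_ h
  refine card_le_card_of_injOn (fun E x => decide (x ∈ E)) (fun E hE => ?_) ?_
  · simpa using hF E hE
  · intro a _ b _ h
    ext x
    simpa using congrFun h x

end Counting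

section Averaging

variable {X : Type*} [Fintype X] [DecidableEq X]

/-- The elements of a subgroup as a finset. -/
noncomputable def elems (G : Subgroup (Equiv.Perm X)) : Finset (Equiv.Perm X) :=
  open Classical in univ.filter (fun g => g ∈ G)

@[simp] theorem mem_elems {G : Subgroup (Equiv.Perm X)} {g : Equiv.Perm X} :
    g ∈ elems G ↔ g ∈ G := by simp [elems]

theorem elems_card_pos (G : Subgroup (Equiv.Perm X)) : 0 < (elems G).card :=
  card_pos.2 ⟨1, by simp [G.one_mem]⟩

theorem card_transport {G : Subgroup (Equiv.Perm X)}
    (hG : ∀ x y : X, ∃ g ∈ G, g x = y) (x y : X) :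
    Fintype.card X * ((elems G).filter (fun g => g x = y)).card = (elems G).card := by
  have h1 : ∀ z, ((elems G).filter (fun g => g x = z)).card
      = ((elems G).filter (fun g => g x = y)).card := by
    intro z
    obtain ⟨k, hk, hkz⟩ := hG z y
    refine card_bij (fun g _ => k * g) ?_ ?_ ?_
    · intro g hg
      simp only [mem_filter, mem_elems] at hg ⊢
      exact ⟨G.mul_mem hk hg.1, by simp [hg.2, hkz]⟩
    · intro a _ b _ h; simpa using h
    · intro g hg
      simp only [mem_filter, mem_elems] at hg
      refine ⟨k⁻¹ * g, ?_, by simp⟩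
      simp only [mem_filter, mem_elems]
      exact ⟨G.mul_mem (G.inv_mem hk) hg.1, by simp [hg.2, ← hkz]⟩
  have h2 := card_eq_sum_card_fiberwise (s := elems G) (f := fun g : Equiv.Perm X => g x)
    (t := univ) (by simp)
  rw [h2]
  simp [h1]

theorem sum_card_filter_map {G : Subgroup (Equiv.Perm X)}
    (hG : ∀ x y : X, ∃ g ∈ G, g x = y) (A B : Finset X) :
    Fintype.card X * ∑ g ∈ elems G, (A.filter (fun x => g x ∈ B)).card
      = A.card * B.card * (elems G).card := by
  have h1 : ∀ g : Equiv.Perm X, (A.filter (fun x => g x ∈ B)).card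
      = ∑ x ∈ A, ∑ y ∈ B, if g x = y then 1 else 0 := by
    intro g
    rw [card_filter]
    refine sum_congr rfl fun x _ => ?_
    simp
  simp_rw [h1]
  rw [sum_comm, mul_sum]
  simp_rw [sum_comm (s := elems G), mul_sum (s := B), ← card_filter, card_transport hG]
  simp [mul_assoc]

theorem exists_spread {T : Type*} {G : Subgroup (Equiv.Perm X)}
    (hG : ∀ x y : X, ∃ g ∈ G, g x = y) (𝒯 : Finset T) (Q : T → Finset X) (l : ℕ) :
    ∃ g : Fin l → Equiv.Perm X, (∀ i, g i ∈ G) ∧ ∃ ov : T → ℕ,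
      (∀ t ∈ 𝒯, ∀ A : Fin l → Finset X, (∀ i, A i ⊆ (Q t).image (g i)) →
        ∑ i, (A i).card ≤ (univ.biUnion A).card + ov t) ∧
      Fintype.card X * ∑ t ∈ 𝒯, ov t ≤ l ^ 2 * ∑ t ∈ 𝒯, (Q t).card ^ 2 := by
  induction l with
  | zero => exact ⟨fun _ => 1, fun i => i.elim0, fun _ => 0, by simp, by simp⟩
  | succ l ih =>
    obtain ⟨g, hg, ov, hov, hsum⟩ := ih
    let V : T → Finset X := fun t => univ.biUnion (fun i => (Q t).image (g i))
    have hV : ∀ t, (V t).card ≤ l * (Q t).card := fun t => by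
      refine card_biUnion_le.trans ?_
      refine (sum_le_sum fun i _ => card_image_le (s := Q t) (f := g i)).trans ?_
      simp
    let c : Equiv.Perm X → T → ℕ := fun a t => ((Q t).filter (fun x => a x ∈ V t)).card
    obtain ⟨a, haG, ha⟩ : ∃ a ∈ elems G, Fintype.card X * ∑ t ∈ 𝒯, c a t
        ≤ l * ∑ t ∈ 𝒯, (Q t).card ^ 2 := by
      refine exists_le_of_sum_le ⟨1, by simp [G.one_mem]⟩ ?_
      rw [← mul_sum, sum_comm, mul_sum]
      simp only [c, sum_card_filter_map hG]
      rw [sum_const, smul_eq_mul, ← sum_mul, mul_comm]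
      gcongr
      rw [mul_sum]
      refine sum_le_sum fun t _ => ?_
      calc (Q t).card * (V t).card ≤ (Q t).card * (l * (Q t).card) := by gcongr; exact hV t
        _ = _ := by ring
    refine ⟨Fin.cons a g, ?_, fun t => ov t + c a t, ?_, ?_⟩
    · intro i
      refine Fin.cases ?_ (fun j => ?_) i
      · simpa using haG
      · simpa using hg j
    · intro t ht A hA
      rw [Fin.sum_univ_succ]
      have h1 := hov t ht (fun i => A i.succ) (fun i => by simpa using hA i.succ)
      set U := univ.biUnion (fun i : Fin l => A i.succ) with hU
      have h0 : A 0 ⊆ (Q t).image a := by simpa using hA 0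
      have hun : A 0 ∪ U ⊆ univ.biUnion A := by
        refine union_subset (subset_biUnion_of_mem A (mem_univ 0)) ?_
        refine biUnion_subset.2 fun i _ => subset_biUnion_of_mem A (mem_univ i.succ)
      have hUV : U ⊆ V t := by
        refine biUnion_mono fun i _ => ?_
        simpa using hA i.succ
      have hint : (A 0 ∩ U).card ≤ c a t := by
        have : A 0 ∩ U ⊆ ((Q t).filter (fun x => a x ∈ V t)).image a := by
          intro x hx
          rw [mem_inter] at hx
          obtain ⟨y, hy, rfl⟩ := mem_image.1 (h0 hx.1)
          exact mem_image_of_mem _ (mem_filter.2 ⟨hy, hUV hx.2⟩)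
        exact (card_le_card this).trans card_image_le
      have := card_le_card hun
      have h3 := card_union_add_card_inter (A 0) U
      dsimp only
      omega
    · rw [sum_add_distrib, mul_add]
      calc _ ≤ l ^ 2 * ∑ t ∈ 𝒯, (Q t).card ^ 2 + l * ∑ t ∈ 𝒯, (Q t).card ^ 2 := by gcongr
        _ ≤ (l + 1) ^ 2 * ∑ t ∈ 𝒯, (Q t).card ^ 2 := by
          rw [← add_mul]; gcongr; nlinarith

end Averaging

section Thin

theorem mul_two_pow_le {F a b c D n : ℕ} (hF : F * 2 ^ a ≤ D * 2 ^ n) (hD : D ≤ 2 ^ b)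
    (h : b + c ≤ a) : F * 2 ^ c ≤ 2 ^ n := by
  have h1 : 2 ^ b * (F * 2 ^ c) ≤ 2 ^ b * 2 ^ n := by
    calc 2 ^ b * (F * 2 ^ c) = F * 2 ^ (b + c) := by rw [pow_add]; ring
      _ ≤ F * 2 ^ a := by gcongr; norm_num
      _ ≤ D * 2 ^ n := hF
      _ ≤ 2 ^ b * 2 ^ n := by gcongr
  exact Nat.le_of_mul_le_mul_left h1 (by positivity)

variable {X : Type*} [Fintype X] [DecidableEq X]

/-- A permutation group with few elements of small support. -/
def Thin (G : Subgroup (Equiv.Perm X)) (q : ℕ) : Prop :=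
  ∀ σ, ((elems G).filter (fun a => a.support.card ≤ σ)).card ≤ 2 ^ (σ / q)

theorem Thin.le_card_support {G : Subgroup (Equiv.Perm X)} {q : ℕ} (hT : Thin G q)
    {a : Equiv.Perm X} (ha : a ∈ G) (ha1 : a ≠ 1) : q ≤ a.support.card := by
  by_contra! hlt
  have h := hT a.support.card
  rw [Nat.div_eq_of_lt hlt, pow_zero, card_le_one] at h
  exact ha1 (h a (by simp [ha]) 1 (by simp [G.one_mem]))

theorem card_mul_eight_le {L : ℕ} (hn : Fintype.card X ≤ 2 ^ L) (F : Finset (Finset X))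
    (f : ℕ → Finset (Finset X)) (hf : ∀ Y ∈ F, ∃ s ∈ Icc 1 (Fintype.card X), Y ∈ f s)
    (hc : ∀ s ∈ Icc 1 (Fintype.card X), (f s).card * 2 ^ (L + 3) ≤ 2 ^ Fintype.card X) :
    F.card * 8 ≤ 2 ^ Fintype.card X := by
  have h1 : F ⊆ (Icc 1 (Fintype.card X)).biUnion f := fun Y hY => mem_biUnion.2 (hf Y hY)
  have h2 : F.card * 8 * 2 ^ L ≤ 2 ^ Fintype.card X * 2 ^ L := by
    calc F.card * 8 * 2 ^ L
        ≤ (∑ s ∈ Icc 1 (Fintype.card X), (f s).card) * 8 * 2 ^ L := by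
          gcongr; exact (card_le_card h1).trans card_biUnion_le
      _ = ∑ s ∈ Icc 1 (Fintype.card X), (f s).card * 2 ^ (L + 3) := by
          rw [mul_assoc, sum_mul]
          refine sum_congr rfl fun s _ => ?_
          rw [pow_add]; ring
      _ ≤ ∑ s ∈ Icc 1 (Fintype.card X), 2 ^ Fintype.card X := sum_le_sum hc
      _ = Fintype.card X * 2 ^ Fintype.card X := by simp
      _ ≤ _ := by rw [mul_comm]; gcongr
  exact Nat.le_of_mul_le_mul_right h2 (by positivity)

/-- Every element of `G` changes `Y` substantially. -/
def Nice (G : Subgroup (Equiv.Perm X)) (C : ℕ) (Y : Finset X) : Prop :=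
  ∀ a ∈ G, a.support.card ≤ C * (univ.filter (fun x => ¬ (x ∈ Y ↔ a x ∈ Y))).card

theorem nonnice_arith {L σ : ℕ} (hL : 10 ^ 9 ≤ L) (hσ : L ^ 20 ≤ σ) :
    (σ / L ^ 20 + (L + 1) * (σ / (16 * L))) + (L + 3) ≤ σ / 2 := by
  have hp : L ^ 2 ≤ L ^ 20 := Nat.pow_le_pow_right (by omega) (by norm_num)
  have h1 : σ / L ^ 20 ≤ σ / 8 := by
    refine Nat.div_le_div_left ?_ (by norm_num)
    nlinarith
  have h2 : (L + 1) * (σ / (16 * L)) ≤ σ / 8 := by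
    rw [Nat.le_div_iff_mul_le (by norm_num)]
    have := Nat.div_mul_le_self σ (16 * L)
    nlinarith
  have h3 : 16 * (L + 4) ≤ σ := by nlinarith
  omega

theorem card_nonnice {G : Subgroup (Equiv.Perm X)} {L : ℕ} (hL : 10 ^ 9 ≤ L)
    (hn : Fintype.card X ≤ 2 ^ L) (hX : 0 < Fintype.card X)
    (hT : Thin G (L ^ 20)) (F : Finset (Finset X)) (hF : ∀ Y ∈ F, ¬ Nice G (16 * L) Y) :
    F.card * 8 ≤ 2 ^ Fintype.card X := by
  classical
  have : Nonempty X := Fintype.card_pos_iff.1 hX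
  let E : Equiv.Perm X → Finset X → Finset X := fun a Y => univ.filter (fun x => ¬ (x ∈ Y ↔ a x ∈ Y))
  let f : ℕ → Finset (Finset X) := fun σ => univ.filter (fun Y => ∃ a ∈ G, a ≠ 1 ∧
    a.support.card = σ ∧ 16 * L * (E a Y).card < σ)
  refine card_mul_eight_le hn F f (fun Y hY => ?_) (fun σ _ => ?_)
  · have := hF Y hY
    simp only [Nice, not_forall, not_le] at this
    obtain ⟨a, ha, hlt⟩ := this
    have hlt : 16 * L * (E a Y).card < a.support.card := hlt
    refine ⟨a.support.card, mem_Icc.2 ⟨by omega, card_le_univ _⟩, ?_⟩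
    simp only [f, mem_filter, mem_univ, true_and]
    refine ⟨a, ha, ?_, rfl, hlt⟩
    rintro rfl
    simp at hlt
  · by_cases hσ : L ^ 20 ≤ σ
    swap
    · have : f σ = ∅ := by
        refine filter_eq_empty_iff.2 fun Y _ => ?_
        rintro ⟨a, ha, ha1, rfl, -⟩
        exact hσ (hT.le_card_support ha ha1)
      simp [this]
    let 𝒟 : Finset (Equiv.Perm X × Finset X) :=
      ((elems G).filter (fun a => a.support.card = σ)) ×ˢ
        (univ.filter (fun E => E.card ≤ σ / (16 * L)))
    have h1 : (f σ).card * 2 ^ (σ / 2) ≤ 𝒟.card * 2 ^ Fintype.card X := by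
      refine card_le_of_relative_union 𝒟 (fun δ x y => δ.1 x = y) (fun δ x _ => x ∉ δ.2) σ ?_ _ ?_
      · rintro ⟨a, e⟩ hδ
        simp only [𝒟, mem_product, mem_filter, mem_elems] at hδ
        refine ⟨a.support, hδ.1.2.ge, fun x hx => ⟨a x, ?_, rfl⟩⟩
        simpa using hx
      · intro Y hY
        simp only [f, mem_filter, mem_univ, true_and] at hY
        obtain ⟨a, ha, -, has, hE⟩ := hY
        refine ⟨(a, E a Y), ?_, ?_⟩
        · simp only [𝒟, mem_product, mem_filter, mem_elems, mem_univ, true_and]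
          refine ⟨⟨ha, has⟩, ?_⟩
          rw [Nat.le_div_iff_mul_le (by omega)]
          linarith
        · rintro x y rfl
          simp [E]
    refine mul_two_pow_le h1 (b := σ / L ^ 20 + (L + 1) * (σ / (16 * L))) ?_ (nonnice_arith hL hσ)
    rw [card_product, pow_add]
    refine Nat.mul_le_mul ?_ ?_
    · refine le_trans (card_le_card ?_) (hT σ)
      intro a ha
      simp only [mem_filter] at ha ⊢
      exact ⟨ha.1, ha.2.le⟩
    · refine (card_finset_le_of_card_le (σ / (16 * L)) _ (by simp)).trans ?_
      rw [pow_mul]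
      gcongr
      rw [pow_succ]
      omega

/-- The permutation `h` maps every translate of `Y` to some translate of `Y`. -/
def Pres (G : Subgroup (Equiv.Perm X)) (Y : Finset X) (h : Equiv.Perm X) : Prop :=
  ∀ g ∈ G, ∃ a ∈ G, ∀ x, (g x ∈ Y ↔ g (a (h x)) ∈ Y)

/-- The permutation `h` has minimal support in the coset `G h`. -/
def Minl (G : Subgroup (Equiv.Perm X)) (h : Equiv.Perm X) : Prop :=
  h ≠ 1 ∧ ∀ a ∈ G, h.support.card ≤ (a * h).support.card

/-- The elements of `G` with support at most `t`. -/
noncomputable def ball (G : Subgroup (Equiv.Perm X)) (t : ℕ) : Finset (Equiv.Perm X) :=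
  (elems G).filter (fun a => a.support.card ≤ t)

theorem Nice.exists_ball {G : Subgroup (Equiv.Perm X)} {C : ℕ} {Y : Finset X} (hY : Nice G C Y)
    {h : Equiv.Perm X} (hp : Pres G Y h) {g : Equiv.Perm X} (hg : g ∈ G) :
    ∃ a ∈ ball G (C * h.support.card), ∀ x, (g x ∈ Y ↔ g (a (h x)) ∈ Y) := by
  obtain ⟨a, ha, hx⟩ := hp g hg
  refine ⟨a, ?_, hx⟩
  simp only [ball, mem_filter, mem_elems, ha, true_and]
  have h1 := hY (g * a * g⁻¹) (G.mul_mem (G.mul_mem hg ha) (G.inv_mem hg))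
  rw [Equiv.Perm.card_support_conj] at h1
  refine h1.trans (Nat.mul_le_mul_left _ ?_)
  rw [← card_image_of_injective h.support g.injective]
  refine card_le_card fun y hy => ?_
  simp only [mem_filter, mem_univ, true_and] at hy
  refine mem_image.2 ⟨g⁻¹ y, ?_, by simp⟩
  rw [Equiv.Perm.mem_support]
  intro hf
  apply hy
  have := hx (g⁻¹ y)
  rw [hf] at this
  simpa using this

end Thin

section Small

variable {X : Type*} [Fintype X] [DecidableEq X]

/-- However one translates, corrections of `h` by elements of small support overlap a lot. -/
def Friend (G : Subgroup (Equiv.Perm X)) (L : ℕ) (h : Equiv.Perm X) : Prop :=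
  ∀ g : Fin (1536 * L ^ 2) → Equiv.Perm X, (∀ i, g i ∈ G) →
    ∃ a : Fin (1536 * L ^ 2) → Equiv.Perm X, (∀ i, a i ∈ ball G (16 * L * h.support.card)) ∧
      (univ.biUnion fun i => (a i * h).support.image (g i)).card ≤ 16 * L * h.support.card

theorem nonfriend_arith {L s : ℕ} (hL : 10 ^ 9 ≤ L) (hs : 1 ≤ s) :
    (2 * L * s + (16 * L * s / L ^ 20) * (1536 * L ^ 2)) + (L + 3) ≤ 16 * L * s / 2 := by
  have h1 : (16 * L * s / L ^ 20) * (1536 * L ^ 2) ≤ s := by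
    have h2 := Nat.div_mul_le_self (16 * L * s) (L ^ 20)
    have h3 : 16 * L * (1536 * L ^ 2) ≤ L ^ 20 := by
      calc 16 * L * (1536 * L ^ 2) = 24576 * L ^ 3 := by ring
        _ ≤ L * L ^ 3 := by gcongr; omega
        _ = L ^ 4 := by ring
        _ ≤ L ^ 20 := Nat.pow_le_pow_right (by omega) (by norm_num)
    have hL' : 0 < 16 * L := by omega
    refine le_of_mul_le_mul_left ?_ hL'
    calc 16 * L * (16 * L * s / L ^ 20 * (1536 * L ^ 2))
        = 16 * L * s / L ^ 20 * (16 * L * (1536 * L ^ 2)) := by ring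
      _ ≤ 16 * L * s / L ^ 20 * L ^ 20 := by gcongr
      _ ≤ _ := h2
  have h4 : 16 * L * s / 2 = 8 * (L * s) := by
    rw [show 16 * L * s = (8 * (L * s)) * 2 by ring]; simp
  have h5 : L ≤ L * s := Nat.le_mul_of_pos_right _ hs
  have h6 : s ≤ L * s := Nat.le_mul_of_pos_left _ (by omega)
  rw [h4, mul_assoc]
  omega

theorem card_nonfriend {G : Subgroup (Equiv.Perm X)} {L : ℕ} (hL : 10 ^ 9 ≤ L)
    (hn : Fintype.card X ≤ 2 ^ L) (hX : 0 < Fintype.card X)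
    (hT : Thin G (L ^ 20)) (F : Finset (Finset X))
    (hF : ∀ Y ∈ F, Nice G (16 * L) Y ∧ ∃ h, h ≠ 1 ∧ ¬ Friend G L h ∧ Pres G Y h) :
    F.card * 8 ≤ 2 ^ Fintype.card X := by
  classical
  have : Nonempty X := Fintype.card_pos_iff.1 hX
  have key : ∀ h : Equiv.Perm X, ∃ g : Fin (1536 * L ^ 2) → Equiv.Perm X, (∀ i, g i ∈ G) ∧
      (¬ Friend G L h → ∀ a : Fin (1536 * L ^ 2) → Equiv.Perm X,
        (∀ i, a i ∈ ball G (16 * L * h.support.card)) →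
        16 * L * h.support.card < (univ.biUnion fun i => (a i * h).support.image (g i)).card) := by
    intro h
    by_cases hf : Friend G L h
    · exact ⟨fun _ => 1, fun _ => G.one_mem, fun hh => (hh hf).elim⟩
    · have hf' := hf
      simp only [Friend, not_forall, not_exists, not_and, not_le] at hf'
      obtain ⟨g, hg, h1⟩ := hf'
      exact ⟨g, hg, fun _ a ha => h1 a ha⟩
  choose gs hgs hgW using key
  let f : ℕ → Finset (Finset X) := fun s => univ.filter (fun Y => ∃ h : Equiv.Perm X,
    h.support.card = s ∧ ¬ Friend G L h ∧
    ∀ g ∈ G, ∃ a ∈ ball G (16 * L * s), ∀ x, (g x ∈ Y ↔ g (a (h x)) ∈ Y))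
  refine card_mul_eight_le hn F f (fun Y hY => ?_) (fun s hs => ?_)
  · obtain ⟨hY, h, h1, hf, hp⟩ := hF Y hY
    refine ⟨h.support.card, mem_Icc.2 ⟨?_, card_le_univ _⟩, ?_⟩
    · exact card_pos.2 (Finset.nonempty_iff_ne_empty.2 (by simpa using h1))
    · simp only [f, mem_filter, mem_univ, true_and]
      exact ⟨h, rfl, hf, fun g hg => hY.exists_ball hp hg⟩
  · have hs1 := (mem_Icc.1 hs).1
    let 𝒟 : Finset (Equiv.Perm X × (Fin (1536 * L ^ 2) → Equiv.Perm X)) :=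
      (univ.filter (fun h => h.support.card = s ∧ ¬ Friend G L h)) ×ˢ
        Fintype.piFinset (fun _ => ball G (16 * L * s))
    have h1 : (f s).card * 2 ^ (16 * L * s / 2) ≤ 𝒟.card * 2 ^ Fintype.card X := by
      refine card_le_of_respecting_union 𝒟
        (fun δ x y => ∃ i, y = gs δ.1 i (δ.2 i (δ.1 ((gs δ.1 i)⁻¹ x)))) _ ?_ _ ?_
      · rintro ⟨h, a⟩ hδ
        simp only [𝒟, mem_product, mem_filter, Fintype.mem_piFinset, mem_univ, true_and] at hδ
        obtain ⟨⟨rfl, hf⟩, ha⟩ := hδ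
        refine ⟨univ.biUnion fun i => (a i * h).support.image (gs h i), (hgW h hf a ha).le, ?_⟩
        intro x hx
        simp only [mem_biUnion, mem_univ, true_and, mem_image, Equiv.Perm.mem_support] at hx
        obtain ⟨i, y, hy, rfl⟩ := hx
        refine ⟨_, ?_, i, rfl⟩
        simpa using hy
      · intro Y hY
        simp only [f, mem_filter, mem_univ, true_and] at hY
        obtain ⟨h, hs, hf, hp⟩ := hY
        choose! a ha hax using hp
        refine ⟨(h, fun i => a (gs h i)), ?_, ?_⟩
        · simp only [𝒟, mem_product, mem_filter, Fintype.mem_piFinset, mem_univ, true_and]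
          exact ⟨⟨hs, hf⟩, fun i => ha _ (hgs h i)⟩
        · rintro x y ⟨i, rfl⟩
          simpa using hax _ (hgs h i) ((gs h i)⁻¹ x)
    refine mul_two_pow_le h1 ?_ (nonfriend_arith hL hs1)
    rw [card_product, pow_add]
    refine Nat.mul_le_mul ?_ ?_
    · refine (card_perm_near_le id s _ ?_).trans ?_
      · intro h hh
        simp only [mem_filter, mem_univ, true_and] at hh
        exact hh.1.le
      · rw [show 2 * L * s = L * 2 * s by ring, pow_mul, pow_mul]
        gcongr
    · rw [Fintype.card_piFinset]
      simp only [prod_const, card_univ, Fintype.card_fin, pow_mul _ _ (1536 * L ^ 2)]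
      gcongr
      exact hT _

theorem Friend.exists_small_inter {G : Subgroup (Equiv.Perm X)} {L : ℕ} (hL : 10 ^ 9 ≤ L)
    (hG : ∀ x y : X, ∃ g ∈ G, g x = y) {h : Equiv.Perm X} (hf : Friend G L h)
    (hs : h.support.card * L ^ 6 ≤ Fintype.card X)
    (Q : Finset X) (hQ : Q.card ≤ 17 * L * h.support.card) :
    ∃ a ∈ ball G (16 * L * h.support.card),
      48 * L * ((a * h).support ∩ Q).card ≤ h.support.card := by
  obtain ⟨g, hg, ov, hov, hsum⟩ := exists_spread hG ({()} : Finset Unit) (fun _ => Q)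
    (1536 * L ^ 2)
  obtain ⟨a, ha, hW⟩ := hf g hg
  set s := h.support.card with hsd
  have h1 := hov () (by simp) (fun i => ((a i * h).support ∩ Q).image (g i))
    (fun i => image_subset_image inter_subset_right)
  have h2 : (univ.biUnion fun i => ((a i * h).support ∩ Q).image (g i)).card ≤ 16 * L * s := by
    refine le_trans (card_le_card ?_) hW
    exact biUnion_mono fun i _ => image_subset_image inter_subset_left
  simp only [card_image_of_injective _ (Equiv.injective _)] at h1
  simp only [sum_singleton] at hsum
  rcases Nat.eq_zero_or_pos s with hs0 | hs0
  · refine ⟨a ⟨0, by positivity⟩, ha _, ?_⟩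
    have : Q = ∅ := by
      rw [← card_eq_zero]; rw [hs0] at hQ; omega
    simp [this]
  have hov' : ov () ≤ 16 * L * s := by
    have hpos : 0 < s * L ^ 6 := by positivity
    refine le_of_mul_le_mul_left ?_ hpos
    calc s * L ^ 6 * ov () ≤ Fintype.card X * ov () := by gcongr
      _ ≤ (1536 * L ^ 2) ^ 2 * Q.card ^ 2 := hsum
      _ ≤ (1536 * L ^ 2) ^ 2 * (17 * L * s) ^ 2 := by gcongr
      _ = 681836544 * (L ^ 6 * s ^ 2) := by ring
      _ ≤ 16 * L * (L ^ 6 * s ^ 2) := by gcongr; omega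
      _ = _ := by ring
  by_contra! hcon
  have h3 : ∀ i, s + 1 ≤ 48 * L * ((a i * h).support ∩ Q).card := fun i => hcon _ (ha i)
  have h4 := sum_le_sum (fun i (_ : i ∈ univ) => h3 i)
  rw [← mul_sum] at h4
  simp only [sum_const, card_univ, Fintype.card_fin, smul_eq_mul] at h4
  have h5 : 48 * L * ∑ i, ((a i * h).support ∩ Q).card ≤ 48 * L * (32 * L * s) := by
    gcongr; linarith
  have h6 : 0 < 1536 * L ^ 2 := by positivity
  nlinarith

theorem friend_arith {L s : ℕ} (hL : 10 ^ 9 ≤ L) (hs : L ^ 20 ≤ 16 * L * s) :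
    ((16 * L * s / L ^ 20 + 16 * L * s / L ^ 20 + 16 * L * s / L ^ 20)
      + L * 2 * (3 * (s / (48 * L)))) + (L + 3) ≤ s / 2 := by
  have hL' : 0 < 16 * L := by omega
  have h0 : 16 * L * 1000 ≤ L ^ 3 := by
    calc 16 * L * 1000 = 16000 * L := by ring
      _ ≤ L ^ 2 * L := by gcongr; nlinarith
      _ = L ^ 3 := by ring
  have h1 : 16 * L * s / L ^ 20 ≤ s / 100 := by
    rw [Nat.le_div_iff_mul_le (by norm_num)]
    have h2 := Nat.div_mul_le_self (16 * L * s) (L ^ 20)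
    have h3 : 16 * L * 100 ≤ L ^ 20 :=
      le_trans (by linarith) (h0.trans (Nat.pow_le_pow_right (by omega) (by norm_num)))
    refine le_of_mul_le_mul_left ?_ hL'
    calc 16 * L * (16 * L * s / L ^ 20 * 100)
        = 16 * L * s / L ^ 20 * (16 * L * 100) := by ring
      _ ≤ 16 * L * s / L ^ 20 * L ^ 20 := by gcongr
      _ ≤ _ := h2
  have h2 : L * 2 * (3 * (s / (48 * L))) ≤ s / 8 := by
    rw [Nat.le_div_iff_mul_le (by norm_num)]
    have := Nat.div_mul_le_self s (48 * L)
    nlinarith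
  have h3 : 1000 * L ≤ s := by
    have h4 : L ^ 3 * L ≤ L ^ 20 := by
      rw [← pow_succ]; exact Nat.pow_le_pow_right (by omega) (by norm_num)
    refine le_of_mul_le_mul_left ?_ hL'
    nlinarith
  generalize 16 * L * s / L ^ 20 = A at *
  generalize L * 2 * (3 * (s / (48 * L))) = B at *
  omega

theorem card_friend {G : Subgroup (Equiv.Perm X)} {L : ℕ} (hL : 10 ^ 9 ≤ L)
    (hG : ∀ x y : X, ∃ g ∈ G, g x = y)
    (hn : Fintype.card X ≤ 2 ^ L) (hX : 0 < Fintype.card X)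
    (hT : Thin G (L ^ 20)) (F : Finset (Finset X))
    (hF : ∀ Y ∈ F, Nice G (16 * L) Y ∧ ∃ h, Minl G h ∧
      h.support.card * L ^ 6 ≤ Fintype.card X ∧ Friend G L h ∧ Pres G Y h) :
    F.card * 8 ≤ 2 ^ Fintype.card X := by
  classical
  have : Nonempty X := Fintype.card_pos_iff.1 hX
  let H : ℕ → Finset (Equiv.Perm X) := fun s => univ.filter (fun h => Minl G h ∧
    h.support.card = s ∧ s * L ^ 6 ≤ Fintype.card X ∧ Friend G L h)
  let f : ℕ → Finset (Finset X) := fun s => univ.filter (fun Y => ∃ h ∈ H s,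
    ∃ a ∈ ball G (16 * L * s), ∀ x, (x ∈ Y ↔ a (h x) ∈ Y))
  have hHball : ∀ s, ∀ h ∈ H s, ∃ a ∈ ball G (16 * L * s), ∃ a' ∈ ball G (16 * L * s),
      48 * L * ((a * h).support ∩ h.support).card ≤ s ∧
      48 * L * ((a' * h).support ∩ (h.support ∪ (a * h).support)).card ≤ s := by
    intro s h hh
    simp only [H, mem_filter, mem_univ, true_and] at hh
    obtain ⟨-, rfl, hs, hf⟩ := hh
    obtain ⟨a, ha, ha1⟩ := hf.exists_small_inter hL hG hs h.support (by nlinarith)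
    have hQ : (h.support ∪ (a * h).support).card ≤ 17 * L * h.support.card := by
      have h1 := card_union_le h.support (a * h).support
      have h2 : (a * h).support.card ≤ a.support.card + h.support.card :=
        (card_le_card (Equiv.Perm.support_mul_le a h)).trans (card_union_le _ _)
      simp only [ball, mem_filter] at ha
      nlinarith
    obtain ⟨a', ha', ha'1⟩ := hf.exists_small_inter hL hG hs _ hQ
    exact ⟨a, ha, a', ha', ha1, ha'1⟩
  refine card_mul_eight_le hn F f (fun Y hY => ?_) (fun s hs => ?_)
  · obtain ⟨hY, h, hm, hs, hf, hp⟩ := hF Y hY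
    refine ⟨h.support.card, mem_Icc.2 ⟨?_, card_le_univ _⟩, ?_⟩
    · exact card_pos.2 (Finset.nonempty_iff_ne_empty.2 (by simpa using hm.1))
    · simp only [f, H, mem_filter, mem_univ, true_and]
      exact ⟨h, ⟨hm, rfl, hs, hf⟩, by simpa using hY.exists_ball hp G.one_mem⟩
  · have hs1 := (mem_Icc.1 hs).1
    rcases (H s).eq_empty_or_nonempty with hE | ⟨h₀, hh₀⟩
    · simp [f, hE]
    have hq : L ^ 20 ≤ 16 * L * s := by
      obtain ⟨a, ha, -, -, ha1, -⟩ := hHball s h₀ hh₀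
      have hne : a ≠ 1 := by
        rintro rfl
        simp only [H, mem_filter, mem_univ, true_and] at hh₀
        rw [one_mul, inter_self, hh₀.2.1] at ha1
        nlinarith
      simp only [ball, mem_filter, mem_elems] at ha
      exact (hT.le_card_support ha.1 hne).trans ha.2
    have hball : (ball G (16 * L * s)).card ≤ 2 ^ (16 * L * s / L ^ 20) := hT _
    let φ : Equiv.Perm X × Equiv.Perm X → X → X := fun p x =>
      if p.1⁻¹ x = x ∨ p.2⁻¹ x = x then x else p.1⁻¹ x
    have hH : (H s).card ≤ 2 ^ (16 * L * s / L ^ 20 + 16 * L * s / L ^ 20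
        + L * 2 * (3 * (s / (48 * L)))) := by
      have hsub : H s ⊆ (ball G (16 * L * s) ×ˢ ball G (16 * L * s)).biUnion (fun p =>
          univ.filter (fun h => (univ.filter (fun x => h x ≠ φ p x)).card
            ≤ 3 * (s / (48 * L)))) := by
        intro h hh
        obtain ⟨a, ha, a', ha', h1, h2⟩ := hHball s h hh
        refine mem_biUnion.2 ⟨(a, a'), mem_product.2 ⟨ha, ha'⟩, ?_⟩
        simp only [mem_filter, mem_univ, true_and]
        have hsub : univ.filter (fun x => h x ≠ φ (a, a') x) ⊆
            ((a * h).support ∩ h.support) ∪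
            (((a' * h).support ∩ (h.support ∪ (a * h).support)) ∪
            ((a' * h).support ∩ (h.support ∪ (a * h).support))) := by
          intro x hx
          have e1 : ∀ c : Equiv.Perm X, c (h x) = x ↔ h x = c⁻¹ x := fun c => by
            rw [Equiv.Perm.eq_inv_iff_eq]
          simp only [φ, mem_filter, mem_univ, true_and] at hx
          simp only [mem_union, mem_inter, Equiv.Perm.mem_support, Equiv.Perm.mul_apply, ne_eq, e1]
          split_ifs at hx with hc
          · rcases hc with hc | hc <;> grind
          · grind
        have h48 : 0 < 48 * L := by omega
        have h3 := (card_le_card hsub).trans (card_union_le _ _)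
        have h4 := card_union_le ((a' * h).support ∩ (h.support ∪ (a * h).support))
          ((a' * h).support ∩ (h.support ∪ (a * h).support))
        have h1' : ((a * h).support ∩ h.support).card ≤ s / (48 * L) :=
          (Nat.le_div_iff_mul_le h48).2 (by linarith)
        have h2' : ((a' * h).support ∩ (h.support ∪ (a * h).support)).card ≤ s / (48 * L) :=
          (Nat.le_div_iff_mul_le h48).2 (by linarith)
        omega
      refine ((card_le_card hsub).trans card_biUnion_le).trans ?_
      refine (sum_le_sum fun p _ => card_perm_near_le (φ p) (3 * (s / (48 * L))) _ ?_).trans ?_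
      · intro h hh
        simpa using hh
      · rw [sum_const, smul_eq_mul, card_product, pow_add, pow_add,
          pow_mul 2 (L * 2), pow_mul 2 L 2]
        exact Nat.mul_le_mul (Nat.mul_le_mul hball hball)
          (Nat.pow_le_pow_left (Nat.pow_le_pow_left hn 2) _)
    let 𝒟 : Finset (Equiv.Perm X × Equiv.Perm X) := ball G (16 * L * s) ×ˢ H s
    have h1 : (f s).card * 2 ^ (s / 2) ≤ 𝒟.card * 2 ^ Fintype.card X := by
      refine card_le_of_respecting_union 𝒟 (fun δ x y => y = δ.1 (δ.2 x)) _ ?_ _ ?_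
      · rintro ⟨a, h⟩ hδ
        simp only [𝒟, H, mem_product, mem_filter, mem_univ, true_and, ball, mem_elems] at hδ
        obtain ⟨⟨ha, -⟩, hm, rfl, -⟩ := hδ
        refine ⟨(a * h).support, hm.2 a ha, fun x hx => ⟨a (h x), ?_, rfl⟩⟩
        simpa using hx
      · intro Y hY
        simp only [f, mem_filter, mem_univ, true_and] at hY
        obtain ⟨h, hh, a, ha, hx⟩ := hY
        refine ⟨(a, h), mem_product.2 ⟨ha, hh⟩, ?_⟩
        rintro x y rfl
        exact hx x
    refine mul_two_pow_le h1 ?_ (friend_arith hL hq)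
    rw [card_product]
    calc _ ≤ 2 ^ (16 * L * s / L ^ 20) * 2 ^ (16 * L * s / L ^ 20 + 16 * L * s / L ^ 20
        + L * 2 * (3 * (s / (48 * L)))) := Nat.mul_le_mul hball hH
      _ = _ := by rw [← pow_add]; congr 1; ring

end Small

section Large

variable {X : Type*} [Fintype X] [DecidableEq X]

theorem exists_large_moved {G : Subgroup (Equiv.Perm X)} {L m l : ℕ} (hL : 0 < L)
    (hl : l = 16 * L ^ 7)
    (hG : ∀ x y : X, ∃ g ∈ G, g x = y) {h : Equiv.Perm X} (hh : Minl G h)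
    (hs : Fintype.card X < h.support.card * L ^ 6) (P : Finset X) (hP : P.card = m)
    (hm : 32 * L ^ 13 * m ≤ Fintype.card X) (hm0 : 0 < m)
    (g : Fin l → Equiv.Perm X) (ov : Equiv.Perm X → ℕ)
    (hov : ∀ t ∈ elems G, ∀ A : Fin l → Finset X,
      (∀ i, A i ⊆ (P.image t).image (g i)) → ∑ i, (A i).card ≤ (univ.biUnion A).card + ov t)
    (hsum : Fintype.card X * ∑ t ∈ elems G, ov t
      ≤ l ^ 2 * ∑ t ∈ elems G, (P.image t).card ^ 2)
    (a : Fin l → Equiv.Perm X) (ha : ∀ i, a i ∈ G) :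
    ∃ t ∈ elems G, 8 * L * m ≤
      (univ.biUnion fun i => ((P.image t) ∩ (a i * h).support).image (g i)).card := by
  by_contra! hcon
  set n := Fintype.card X
  set s := h.support.card
  have hcard : 0 < (elems G).card := elems_card_pos G
  have h1 : ∀ i, m * s * (elems G).card
      ≤ n * ∑ t ∈ elems G, ((P.image t) ∩ (a i * h).support).card := by
    intro i
    have e : ∀ t : Equiv.Perm X, (P.filter (fun x => t x ∈ (a i * h).support)).card
        = ((P.image t) ∩ (a i * h).support).card := by
      intro t
      rw [← card_image_of_injective _ t.injective]
      congr 1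
      ext y
      simp only [mem_image, mem_filter, mem_inter]
      grind
    simp only [← e]
    rw [sum_card_filter_map hG, hP]
    gcongr
    exact hh.2 _ (ha i)
  have h2 : ∀ t ∈ elems G, ∑ i, ((P.image t) ∩ (a i * h).support).card + 1 ≤ 8 * L * m + ov t := by
    intro t ht
    have := hov t ht (fun i => ((P.image t) ∩ (a i * h).support).image (g i))
      (fun i => image_subset_image inter_subset_left)
    simp only [card_image_of_injective _ (Equiv.injective _)] at this
    have := hcon t ht
    omega
  have h3 : l * (m * s * (elems G).card)
      ≤ n * ∑ t ∈ elems G, ∑ i, ((P.image t) ∩ (a i * h).support).card := by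
    rw [sum_comm, mul_sum]
    refine le_trans ?_ (sum_le_sum fun i _ => h1 i)
    simp
  have h4 := sum_le_sum h2
  simp only [sum_add_distrib, sum_const, smul_eq_mul, mul_one] at h4
  simp only [card_image_of_injective _ (Equiv.injective _), hP, sum_const, smul_eq_mul] at hsum
  set c := (elems G).card
  set A := ∑ t ∈ elems G, ∑ i, ((P.image t) ∩ (a i * h).support).card
  set O := ∑ t ∈ elems G, ov t
  have h5 : l * (m * s * c) + n * c ≤ n * (c * (8 * L * m)) + l ^ 2 * (c * m ^ 2) := by nlinarith
  have h6 : l * (m * s) + n ≤ n * (8 * L * m) + l ^ 2 * m ^ 2 := by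
    refine le_of_mul_le_mul_left (a := c) ?_ hcard
    nlinarith
  have hn0 : 0 < n := lt_of_lt_of_le (by positivity) hm
  have h7 : n * (l * m) ≤ L ^ 6 * (l * (m * s)) := by
    calc n * (l * m) ≤ (s * L ^ 6) * (l * m) := by gcongr
      _ = _ := by ring
  have h8 : n * (16 * L ^ 7 * m) + L ^ 6 * n ≤ n * (8 * L ^ 7 * m) + 256 * L ^ 20 * m ^ 2 := by
    have := Nat.mul_le_mul_left (L ^ 6) h6
    rw [hl] at this h7
    nlinarith
  have h9 : 256 * L ^ 20 * m ^ 2 ≤ n * (8 * L ^ 7 * m) := by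
    calc 256 * L ^ 20 * m ^ 2 = 32 * L ^ 13 * m * (8 * L ^ 7 * m) := by ring
      _ ≤ _ := by gcongr
  have h10 : 0 < L ^ 6 * n := by positivity
  nlinarith

theorem large_arith {L n : ℕ} (hL : 10 ^ 9 ≤ L) (hn : L ^ 50 ≤ n) :
    (n / L ^ 20 * (16 * L ^ 7 + 1) + L * (n / (32 * L ^ 13))) + 3
      ≤ 8 * L * (n / (32 * L ^ 13)) / 2 := by
  set m := n / (32 * L ^ 13) with hm
  have hLpos : 0 < L := by omega
  have h0 : n < 32 * L ^ 13 * (m + 1) := by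
    have := Nat.lt_mul_div_succ n (show 0 < 32 * L ^ 13 by positivity)
    simpa [hm] using this
  have h1 : n / L ^ 20 * (16 * L ^ 7 + 1) ≤ 544 * (m + 1) := by
    have h2 := Nat.div_mul_le_self n (L ^ 20)
    refine le_of_mul_le_mul_left (a := L ^ 20) ?_ (by positivity)
    calc L ^ 20 * (n / L ^ 20 * (16 * L ^ 7 + 1)) = (n / L ^ 20 * L ^ 20) * (16 * L ^ 7 + 1) := by ring
      _ ≤ n * (16 * L ^ 7 + 1) := by gcongr
      _ ≤ 32 * L ^ 13 * (m + 1) * (16 * L ^ 7 + 1) := by gcongr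
      _ ≤ 32 * L ^ 13 * (m + 1) * (17 * L ^ 7) := by
          gcongr
          have : 1 ≤ L ^ 7 := Nat.one_le_pow _ _ hLpos
          omega
      _ = L ^ 20 * (544 * (m + 1)) := by ring
  have hm1 : 4 ≤ m := by
    rw [hm, Nat.le_div_iff_mul_le (by positivity)]
    calc 4 * (32 * L ^ 13) = 128 * L ^ 13 := by ring
      _ ≤ L * L ^ 13 := by gcongr; omega
      _ = L ^ 14 := by ring
      _ ≤ L ^ 50 := Nat.pow_le_pow_right hLpos (by norm_num)
      _ ≤ n := hn
  have h3 : 8 * L * m / 2 = 4 * (L * m) := by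
    rw [show 8 * L * m = (4 * (L * m)) * 2 by ring]; simp
  have h4 : 10 ^ 9 * m ≤ L * m := by gcongr
  rw [h3]
  omega

theorem card_large {G : Subgroup (Equiv.Perm X)} {L : ℕ} (hL : 10 ^ 9 ≤ L)
    (hG : ∀ x y : X, ∃ g ∈ G, g x = y)
    (hn : Fintype.card X ≤ 2 ^ L) (hn' : L ^ 50 ≤ Fintype.card X)
    (hT : Thin G (L ^ 20)) (F : Finset (Finset X))
    (hF : ∀ Y ∈ F, ∃ h, Minl G h ∧ Fintype.card X < h.support.card * L ^ 6 ∧ Pres G Y h) :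
    F.card * 8 ≤ 2 ^ Fintype.card X := by
  classical
  obtain ⟨l, hl⟩ : ∃ l, l = 16 * L ^ 7 := ⟨_, rfl⟩
  obtain ⟨m, hm⟩ : ∃ m, m = Fintype.card X / (32 * L ^ 13) := ⟨_, rfl⟩
  have hLpos : 0 < L := by omega
  have hm' : 32 * L ^ 13 * m ≤ Fintype.card X := by rw [hm]; exact Nat.mul_div_le _ _
  have hm0 : 0 < m := by
    rw [hm, Nat.div_pos_iff]
    refine ⟨by positivity, le_trans ?_ hn'⟩
    calc 32 * L ^ 13 ≤ L * L ^ 13 := by gcongr; omega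
      _ = L ^ 14 := by ring
      _ ≤ L ^ 50 := Nat.pow_le_pow_right hLpos (by norm_num)
  obtain ⟨P, -, hP⟩ := exists_subset_card_eq (s := (univ : Finset X)) (n := m) (by
    rw [card_univ, hm]; exact Nat.div_le_self _ _)
  obtain ⟨g, hg, ov, hov, hsum⟩ := exists_spread hG (elems G) (fun t => P.image t) l
  let R : Equiv.Perm X × (Fin l → Equiv.Perm X) × (P → X) → X → X → Prop := fun δ x y =>
    ∃ i, ∃ p : P, x = g i (δ.1 p) ∧ y = g i (δ.2.1 i (δ.2.2 p))
  let 𝒟 : Finset (Equiv.Perm X × (Fin l → Equiv.Perm X) × (P → X)) :=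
    (elems G ×ˢ Fintype.piFinset (fun _ => elems G) ×ˢ univ).filter
      (fun δ => ∃ W : Finset X, 8 * L * m ≤ W.card ∧ ∀ x ∈ W, ∃ y, y ≠ x ∧ R δ x y)
  have h1 : F.card * 2 ^ (8 * L * m / 2) ≤ 𝒟.card * 2 ^ Fintype.card X := by
    refine card_le_of_respecting_union 𝒟 R _ (fun δ hδ => (mem_filter.1 hδ).2) F ?_
    intro Y hY
    obtain ⟨h, hmin, hs, hp⟩ := hF Y hY
    choose! a ha hax using hp
    obtain ⟨t, ht, hW⟩ := exists_large_moved hLpos hl hG hmin hs P hP hm' hm0 g ov hov hsum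
      (fun i => a (g i)) (fun i => ha _ (hg i))
    refine ⟨(t, fun i => a (g i), fun p => h (t p)), mem_filter.2 ⟨?_, _, hW, ?_⟩, ?_⟩
    · simp only [mem_product, Fintype.mem_piFinset, mem_univ, and_true]
      exact ⟨ht, fun i => by simpa using ha _ (hg i)⟩
    · intro x hx
      simp only [mem_biUnion, mem_univ, true_and, mem_image, mem_inter,
        Equiv.Perm.mem_support] at hx
      obtain ⟨i, y, ⟨⟨p, hp, rfl⟩, hy⟩, rfl⟩ := hx
      refine ⟨g i (a (g i) (h (t p))), ?_, i, ⟨p, hp⟩, rfl, rfl⟩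
      simpa using hy
    · rintro x y ⟨i, p, rfl, rfl⟩
      exact hax _ (hg i) _
  refine mul_two_pow_le (c := 3) h1 ?_ (hm ▸ large_arith hL hn')
  have hGc : (elems G).card ≤ 2 ^ (Fintype.card X / L ^ 20) := by
    refine le_trans (card_le_card ?_) (hT (Fintype.card X))
    intro a ha
    exact mem_filter.2 ⟨ha, card_le_univ _⟩
  refine (card_filter_le _ _).trans ?_
  rw [card_product, card_product, Fintype.card_piFinset, ← mul_assoc]
  simp only [prod_const, card_univ, Fintype.card_fin, Fintype.card_pi, Fintype.card_coe, hP]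
  rw [← hl, pow_add, pow_mul, pow_mul, ← pow_succ']
  gcongr

end Large

section Assembly

variable {X : Type*} [Fintype X] [DecidableEq X]

theorem exists_good_set {G : Subgroup (Equiv.Perm X)} {L : ℕ} (hL : 10 ^ 9 ≤ L)
    (hG : ∀ x y : X, ∃ g ∈ G, g x = y)
    (hn : Fintype.card X ≤ 2 ^ L) (hn' : L ^ 50 ≤ Fintype.card X)
    (hT : Thin G (L ^ 20)) : ∃ Y : Finset X, ∀ h, Minl G h → ¬ Pres G Y h := by
  classical
  by_contra! hcon
  have hX : 0 < Fintype.card X := lt_of_lt_of_le (by positivity) hn'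
  let F₁ : Finset (Finset X) := univ.filter (fun Y => ¬ Nice G (16 * L) Y)
  let F₂ : Finset (Finset X) := univ.filter (fun Y => Nice G (16 * L) Y ∧
    ∃ h, h ≠ 1 ∧ ¬ Friend G L h ∧ Pres G Y h)
  let F₃ : Finset (Finset X) := univ.filter (fun Y => Nice G (16 * L) Y ∧ ∃ h, Minl G h ∧
      h.support.card * L ^ 6 ≤ Fintype.card X ∧ Friend G L h ∧ Pres G Y h)
  let F₄ : Finset (Finset X) := univ.filter (fun Y => ∃ h, Minl G h ∧
    Fintype.card X < h.support.card * L ^ 6 ∧ Pres G Y h)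
  have h1 : F₁.card * 8 ≤ _ := card_nonnice hL hn hX hT F₁ (by simp [F₁])
  have h2 : F₂.card * 8 ≤ _ := card_nonfriend hL hn hX hT F₂ (by simp [F₂])
  have h3 : F₃.card * 8 ≤ _ := card_friend hL hG hn hX hT F₃ (by simp [F₃])
  have h4 : F₄.card * 8 ≤ _ := card_large hL hG hn hn' hT F₄ (by simp [F₄])
  have hcov : (univ : Finset (Finset X)) ⊆ (F₁ ∪ F₂) ∪ (F₃ ∪ F₄) := by
    intro Y _
    obtain ⟨h, hm, hp⟩ := hcon Y
    simp only [mem_union, F₁, F₂, F₃, F₄, mem_filter, mem_univ, true_and]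
    by_cases hY : Nice G (16 * L) Y
    swap
    · exact .inl (.inl hY)
    rcases le_or_gt (h.support.card * L ^ 6) (Fintype.card X) with hs | hs
    · by_cases hf : Friend G L h
      · exact .inr (.inl ⟨hY, h, hm, hs, hf, hp⟩)
      · exact .inl (.inr ⟨hY, h, hm.1, hf, hp⟩)
    · exact .inr (.inr ⟨h, hm, hs, hp⟩)
  have h5 := card_le_card hcov
  have h6 := card_union_le (F₁ ∪ F₂) (F₃ ∪ F₄)
  have h7 := card_union_le F₁ F₂
  have h8 := card_union_le F₃ F₄
  rw [card_univ, Fintype.card_finset] at h5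
  have h9 : 0 < 2 ^ Fintype.card X := by positivity
  omega

theorem mem_of_pres {G : Subgroup (Equiv.Perm X)} {Y : Finset X}
    (hY : ∀ h, Minl G h → ¬ Pres G Y h) {σ : Equiv.Perm X} (hσ : Pres G Y σ) : σ ∈ G := by
  obtain ⟨a, ha, hmin⟩ := exists_min_image (elems G) (fun a => (a * σ).support.card)
    ⟨1, by simp [G.one_mem]⟩
  simp only [mem_elems] at ha hmin
  by_contra hσG
  refine hY (a * σ) ⟨?_, fun b hb => ?_⟩ ?_
  · intro h
    rw [mul_eq_one_iff_inv_eq] at h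
    exact hσG (h ▸ G.inv_mem ha)
  · rw [← mul_assoc]
    exact hmin _ (G.mul_mem hb ha)
  · intro g hg
    obtain ⟨b, hb, h⟩ := hσ g hg
    exact ⟨b * a⁻¹, G.mul_mem hb (G.inv_mem ha), fun x => by simpa using h x⟩

theorem exists_family_of_good {G : Subgroup (Equiv.Perm X)} {Y : Finset X}
    (hY : ∀ h, Minl G h → ¬ Pres G Y h) :
    ∃ k : ℕ, k ≤ Fintype.card X ∧
      ∃ ℬ : Set (Set X), ℬ.Nonempty ∧ (∀ B ∈ ℬ, B.ncard = k) ∧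
        (∀ σ : Equiv.Perm X, ((fun Y : Set X => (σ : X → X) '' Y) '' ℬ = ℬ) ↔ σ ∈ G) ∧
        (∀ B₁ ∈ ℬ, ∀ B₂ ∈ ℬ, ∃ g ∈ G, (g : X → X) '' B₁ = B₂) := by
  have himg : ∀ (g h : Equiv.Perm X) (S : Set X), g '' (h '' S) = (g * h : Equiv.Perm X) '' S := by
    intro g h S
    rw [Set.image_image]; rfl
  have hmem : ∀ (g : Equiv.Perm X) (y : X), y ∈ g '' (Y : Set X) ↔ g⁻¹ y ∈ Y := by
    intro g y
    constructor
    · rintro ⟨x, hx, rfl⟩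
      simpa using hx
    · exact fun h => ⟨g⁻¹ y, h, by simp⟩
  refine ⟨Y.card, card_le_univ _, {B | ∃ g ∈ G, B = (g : X → X) '' (Y : Set X)},
    ⟨_, 1, G.one_mem, rfl⟩, ?_, ?_, ?_⟩
  · rintro B ⟨g, -, rfl⟩
    rw [Set.ncard_image_of_injective _ g.injective, Set.ncard_coe_finset]
  · intro σ
    constructor
    · intro h
      refine mem_of_pres hY fun g hg => ?_
      have h1 : (σ : X → X) '' ((g⁻¹ : Equiv.Perm X) '' (Y : Set X)) ∈
          {B | ∃ g ∈ G, B = (g : X → X) '' (Y : Set X)} := by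
        rw [← h]
        exact ⟨_, ⟨g⁻¹, G.inv_mem hg, rfl⟩, rfl⟩
      obtain ⟨b, hb, hbe⟩ := h1
      refine ⟨g⁻¹ * b⁻¹, G.mul_mem (G.inv_mem hg) (G.inv_mem hb), fun x => ?_⟩
      have h2 := Set.ext_iff.1 hbe (σ x)
      rw [himg] at h2
      rw [hmem, hmem] at h2
      simpa using h2
    · intro hσ
      ext B
      constructor
      · rintro ⟨_, ⟨g, hg, rfl⟩, rfl⟩
        exact ⟨σ * g, G.mul_mem hσ hg, himg _ _ _⟩
      · rintro ⟨g, hg, rfl⟩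
        refine ⟨_, ⟨σ⁻¹ * g, G.mul_mem (G.inv_mem hσ) hg, rfl⟩, ?_⟩
        dsimp only
        rw [himg]
        simp
  · rintro _ ⟨g, hg, rfl⟩ _ ⟨h, hh, rfl⟩
    exact ⟨h * g⁻¹, G.mul_mem hh (G.inv_mem hg), by rw [himg]; simp⟩

end Assembly

section Primitive

variable {X : Type*} {G : Subgroup (Equiv.Perm X)}

theorem _root_.IsPrimitiveSubgroup.transitive (h : IsPrimitiveSubgroup G) (x y : X) :
    ∃ g ∈ G, g x = y := by
  obtain ⟨⟨g, hg⟩, hgx⟩ := h.1.exists_smul_eq x y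
  exact ⟨g, hg, hgx⟩

/-- An invariant equivalence relation of a primitive group is trivial. -/
theorem _root_.IsPrimitiveSubgroup.setoid_trivial (h : IsPrimitiveSubgroup G) (s : Setoid X)
    (hs : ∀ g ∈ G, ∀ x y, s x y → s (g x) (g y)) {a b : X} (hab : a ≠ b) (hr : s a b) (x y : X) :
    s x y := by
  have hs' : ∀ g ∈ G, ∀ x y, s (g x) (g y) → s x y := by
    intro g hg x y hxy
    simpa using hs g⁻¹ (G.inv_mem hg) _ _ hxy
  have hB : MulAction.IsBlock G {z | s a z} := by
    intro g₁ g₂ hne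
    rw [Set.disjoint_left]
    rintro _ ⟨z₁, hz₁, rfl⟩ ⟨z₂, hz₂, h12⟩
    apply hne
    have e1 : (g₂ : Equiv.Perm X) z₂ = (g₁ : Equiv.Perm X) z₁ := h12
    have key : ∀ z, s a ((g₁ : Equiv.Perm X)⁻¹ z) ↔ s a ((g₂ : Equiv.Perm X)⁻¹ z) := by
      intro z
      have h1 : s a ((g₁ : Equiv.Perm X)⁻¹ z) ↔ s ((g₁ : Equiv.Perm X) z₁) z := by
        constructor
        · intro hz
          have := hs g₁ g₁.2 _ _ (s.trans (s.symm hz₁) hz)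
          simpa using this
        · intro hz
          refine s.trans hz₁ (hs' g₁ g₁.2 _ _ (by simpa using hz))
      have h2 : s a ((g₂ : Equiv.Perm X)⁻¹ z) ↔ s ((g₂ : Equiv.Perm X) z₂) z := by
        constructor
        · intro hz
          have := hs g₂ g₂.2 _ _ (s.trans (s.symm hz₂) hz)
          simpa using this
        · intro hz
          refine s.trans hz₂ (hs' g₂ g₂.2 _ _ (by simpa using hz))
      rw [h1, h2, e1]
    ext z
    rw [Set.mem_smul_set_iff_inv_smul_mem, Set.mem_smul_set_iff_inv_smul_mem]
    exact key z
  rcases h.2 _ hB with h1 | h1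
  · exact (hab (h1 (s.refl a) hr)).elim
  · have h2 : ∀ z, s a z := fun z => by
      have : z ∈ {z | s a z} := by rw [h1]; trivial
      exact this
    exact s.trans (s.symm (h2 x)) (h2 y)

theorem _root_.IsPrimitiveSubgroup.eqvGen (h : IsPrimitiveSubgroup G) (r : X → X → Prop)
    (hr : ∀ g ∈ G, ∀ x y, r x y → r (g x) (g y)) {a b : X} (hab : a ≠ b) (h0 : r a b) (x y : X) :
    Relation.EqvGen r x y := by
  refine h.setoid_trivial (Relation.EqvGen.setoid r) (fun g hg x y hxy => ?_) hab (.rel _ _ h0) x y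
  change Relation.EqvGen r x y at hxy
  change Relation.EqvGen r (g x) (g y)
  induction hxy with
  | rel x y h => exact .rel _ _ (hr g hg x y h)
  | refl x => exact .refl _
  | symm x y _ ih => exact .symm _ _ ih
  | trans x y z _ _ ih1 ih2 => exact .trans _ _ _ ih1 ih2

end Primitive

section Graph

variable {V : Type*} {Γ : SimpleGraph V}

theorem exists_adj_dist_succ (hc : Γ.Connected) {u x : V} (hx : x ≠ u) :
    ∃ y, Γ.Adj x y ∧ Γ.dist y u + 1 = Γ.dist x u := by
  obtain ⟨p, hp⟩ := hc.exists_walk_length_eq_dist x u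
  cases p with
  | nil => exact (hx rfl).elim
  | @cons _ y _ hxy p =>
    refine ⟨y, hxy, ?_⟩
    have h1 := Γ.dist_le p
    have h2 := hc.dist_triangle (u := x) (v := y) (w := u)
    rw [SimpleGraph.dist_eq_one_iff_adj.2 hxy] at h2
    rw [SimpleGraph.Walk.length_cons] at hp
    omega

theorem exists_dist_eq (hc : Γ.Connected) (u v : V) {i : ℕ} (hi : i ≤ Γ.dist v u) :
    ∃ w, Γ.dist w u = i := by
  induction hn : Γ.dist v u - i generalizing v with
  | zero => exact ⟨v, by omega⟩
  | succ k ih =>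
    have hvu : v ≠ u := by
      rintro rfl
      simp at hn
    obtain ⟨y, -, hy⟩ := exists_adj_dist_succ hc hvu
    exact ih y (by omega) (by omega)

theorem dist_mul_degree_le [Fintype V] [DecidableRel Γ.Adj] (hc : Γ.Connected) {k : ℕ}
    (hk : ∀ x, Γ.degree x = k) (u v : V) : (Γ.dist v u + 1) * k ≤ 3 * Fintype.card V := by
  classical
  have : ∀ i : Fin (Γ.dist v u + 1), ∃ w, Γ.dist w u = i := fun i =>
    exists_dist_eq hc u v (by omega)
  choose w hw using this
  calc (Γ.dist v u + 1) * k = ∑ i, (univ.filter (fun y => Γ.Adj (w i) y)).card := by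
        have e : ∀ i, (univ.filter (fun y => Γ.Adj (w i) y)).card = k := fun i => by
          rw [← hk (w i), ← Γ.card_neighborFinset_eq_degree, Γ.neighborFinset_eq_filter]
        simp [e]
    _ = ∑ y, (univ.filter (fun i => Γ.Adj (w i) y)).card := by
        simp_rw [card_filter]
        rw [sum_comm]
    _ ≤ ∑ y : V, 3 := by
        refine sum_le_sum fun y _ => ?_
        have hsub : (univ.filter (fun i => Γ.Adj (w i) y)).image Fin.val ⊆
            Icc (Γ.dist y u - 1) (Γ.dist y u + 1) := by
          intro j hj
          obtain ⟨i, hi, rfl⟩ := mem_image.1 hj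
          simp only [mem_filter, mem_univ, true_and] at hi
          have h1 := hc.dist_triangle (u := w i) (v := y) (w := u)
          have h2 := hc.dist_triangle (u := y) (v := w i) (w := u)
          rw [SimpleGraph.dist_eq_one_iff_adj.2 hi] at h1
          rw [SimpleGraph.dist_eq_one_iff_adj.2 hi.symm] at h2
          rw [hw] at h1 h2
          rw [mem_Icc]
          omega
        rw [← card_image_of_injective _ Fin.val_injective]
        refine (card_le_card hsub).trans ?_
        simp
        omega
    _ = 3 * Fintype.card V := by simp [mul_comm]

end Graph

section Separation

variable {X : Type*} [Fintype X] [DecidableEq X] {G : Subgroup (Equiv.Perm X)}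

/-- The points `z` such that `x` and `y` lie in different orbits of the stabiliser of `z`. -/
noncomputable def sep (G : Subgroup (Equiv.Perm X)) (x y : X) : Finset X :=
  open Classical in univ.filter (fun z => ∀ g ∈ G, g z = z → g x ≠ y)

theorem mem_sep {x y z : X} : z ∈ sep G x y ↔ ∀ g ∈ G, g z = z → g x ≠ y := by
  simp [sep]

theorem sep_self (x : X) : sep G x x = ∅ := by
  ext z
  simp only [mem_sep, notMem_empty, iff_false, not_forall]
  exact ⟨1, G.one_mem, rfl, by simp⟩

theorem sep_comm (x y : X) : sep G x y = sep G y x := by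
  have : ∀ x y, sep G x y ⊆ sep G y x := by
    intro x y z hz
    rw [mem_sep] at hz ⊢
    intro g hg hgz hgy
    exact hz g⁻¹ (G.inv_mem hg) (by rw [Equiv.Perm.inv_eq_iff_eq, hgz])
      (by rw [Equiv.Perm.inv_eq_iff_eq, hgy])
  exact Subset.antisymm (this _ _) (this _ _)

theorem sep_map {a : Equiv.Perm X} (ha : a ∈ G) (x y : X) :
    sep G (a x) (a y) = (sep G x y).image a := by
  ext z
  constructor
  · intro hz
    refine mem_image.2 ⟨a⁻¹ z, ?_, by simp⟩
    rw [mem_sep] at hz ⊢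
    intro g hg hgz hgx
    refine hz (a * g * a⁻¹) (G.mul_mem (G.mul_mem ha hg) (G.inv_mem ha)) ?_ ?_
    · rw [Equiv.Perm.mul_apply, Equiv.Perm.mul_apply, hgz]; simp
    · simp [hgx]
  · intro hz
    obtain ⟨z, hz', rfl⟩ := mem_image.1 hz
    rw [mem_sep] at hz' ⊢
    intro g hg hgz hgx
    refine hz' (a⁻¹ * g * a) (G.mul_mem (G.mul_mem (G.inv_mem ha) hg) ha) ?_ ?_
    · simp [hgz]
    · simp [hgx]

theorem card_sep_map {a : Equiv.Perm X} (ha : a ∈ G) (x y : X) :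
    (sep G (a x) (a y)).card = (sep G x y).card := by
  rw [sep_map ha, card_image_of_injective _ a.injective]

theorem sep_subset (x y z : X) : sep G x z ⊆ sep G x y ∪ sep G y z := by
  intro w hw
  by_contra hcon
  simp only [mem_union, not_or, mem_sep, not_forall, not_not] at hcon
  obtain ⟨⟨g, hg, hgw, hgx⟩, k, hk, hkw, hky⟩ := hcon
  exact mem_sep.1 hw (k * g) (G.mul_mem hk hg) (by simp [hgw, hkw]) (by simp [hgx, hky])

/-- The graph joining points that are separated by few points. -/
def closeGraph (G : Subgroup (Equiv.Perm X)) (d : ℕ) : SimpleGraph X where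
  Adj x y := x ≠ y ∧ (sep G x y).card ≤ d
  symm := ⟨fun x y h => ⟨h.1.symm, by rw [sep_comm]; exact h.2⟩⟩
  loopless := ⟨fun x h => h.1 rfl⟩

theorem closeGraph_adj_map {d : ℕ} {a : Equiv.Perm X} (ha : a ∈ G) (x y : X) :
    (closeGraph G d).Adj (a x) (a y) ↔ (closeGraph G d).Adj x y := by
  simp [closeGraph, card_sep_map ha]

/-- An element of `G` as an automorphism of the graph. -/
def closeIso {d : ℕ} {a : Equiv.Perm X} (ha : a ∈ G) : closeGraph G d ≃g closeGraph G d where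
  toEquiv := a
  map_rel_iff' := closeGraph_adj_map ha _ _

theorem closeGraph_dist_map {d : ℕ} {a : Equiv.Perm X} (ha : a ∈ G)
    (hc : (closeGraph G d).Connected) (x y : X) :
    (closeGraph G d).dist (a x) (a y) = (closeGraph G d).dist x y := by
  have key : ∀ b ∈ G, ∀ x y, (closeGraph G d).dist (b x) (b y) ≤ (closeGraph G d).dist x y := by
    intro b hb x y
    obtain ⟨p, hp⟩ := hc.exists_walk_length_eq_dist x y
    rw [← hp, ← SimpleGraph.Walk.length_map (closeIso hb).toHom p]
    exact SimpleGraph.dist_le _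
  refine le_antisymm (key a ha x y) ?_
  have := key a⁻¹ (G.inv_mem ha) (a x) (a y)
  simpa using this

theorem card_sep_le_length {d : ℕ} {u v : X} (p : (closeGraph G d).Walk u v) :
    (sep G u v).card ≤ p.length * d := by
  induction p with
  | nil => simp [sep_self]
  | @cons u v w h p ih =>
    rw [SimpleGraph.Walk.length_cons]
    have h1 := (card_le_card (sep_subset (G := G) u v w)).trans (card_union_le _ _)
    have h2 := h.2
    linarith

/-- If some pair is separated by few points, then so is every pair. -/
theorem card_sep_le (hG : IsPrimitiveSubgroup G) {d : ℕ} {a b : X} (hab : a ≠ b)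
    (hd : (sep G a b).card ≤ d) (u v : X) : (sep G u v).card ≤ 6 * d ^ 2 := by
  classical
  set Γ := closeGraph G d with hΓ
  have hc : Γ.Connected := by
    rw [SimpleGraph.connected_iff]
    refine ⟨fun x y => ?_, ⟨a⟩⟩
    have := hG.eqvGen Γ.Adj (fun g hg x y h => (closeGraph_adj_map hg x y).2 h) hab ⟨hab, hd⟩ x y
    induction this with
    | rel x y h => exact h.reachable
    | refl x => exact .refl _
    | symm x y _ ih => exact ih.symm
    | trans x y z _ _ ih1 ih2 => exact ih1.trans ih2
  set n := Fintype.card X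
  have hn : 2 ≤ n := by
    have : Nontrivial X := ⟨a, b, hab⟩
    exact Fintype.one_lt_card
  obtain ⟨k, hk⟩ : ∃ k, ∀ x, Γ.degree x = k := by
    refine ⟨Γ.degree a, fun x => ?_⟩
    obtain ⟨g, hg, rfl⟩ := hG.transitive a x
    exact (closeIso hg).degree_eq a
  have hi : n * (n - 1) ≤ n * k * d := by
    have e1 : ∀ z : X, n - 1 ≤ ((univ : Finset (X × X)).filter
        (fun p => Γ.Adj p.1 p.2 ∧ z ∈ sep G p.1 p.2)).card := by
      intro z
      have : ∀ x, ∃ y, x ≠ z → Γ.Adj x y ∧ Γ.dist y z + 1 = Γ.dist x z := by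
        intro x
        by_cases hx : x = z
        · exact ⟨x, fun h => (h hx).elim⟩
        · obtain ⟨y, hy⟩ := exists_adj_dist_succ hc hx
          exact ⟨y, fun _ => hy⟩
      choose y hy using this
      have hcard : (univ.erase z).card = n - 1 := by
        rw [card_erase_of_mem (mem_univ z), card_univ]
      rw [← hcard]
      refine card_le_card_of_injOn (fun x => (x, y x)) (fun x hx => ?_) ?_
      · have hxz : x ≠ z := by simpa using hx
        obtain ⟨h1, h2⟩ := hy x hxz
        simp only [coe_filter, mem_univ, true_and, Set.mem_ofPred_eq, mem_sep]
        refine ⟨h1, fun g hg hgz hgx => ?_⟩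
        have : Γ.dist (g x) (g z) = Γ.dist x z := closeGraph_dist_map hg hc x z
        rw [hgx, hgz] at this
        omega
      · intro x _ x' _ h
        exact (Prod.ext_iff.1 h).1
    calc n * (n - 1) = ∑ z : X, (n - 1) := by simp [n]
      _ ≤ ∑ z : X, ((univ : Finset (X × X)).filter
        (fun p => Γ.Adj p.1 p.2 ∧ z ∈ sep G p.1 p.2)).card := sum_le_sum fun z _ => e1 z
      _ = ∑ p : X × X, (univ.filter (fun z => Γ.Adj p.1 p.2 ∧ z ∈ sep G p.1 p.2)).card := by
        simp only [card_filter]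
        rw [sum_comm]
      _ ≤ ∑ p : X × X, if Γ.Adj p.1 p.2 then d else 0 := by
        refine sum_le_sum fun p _ => ?_
        split_ifs with hp
        · simp only [hp, true_and, filter_mem_eq_inter, univ_inter]
          exact hp.2
        · simp [hp]
      _ = n * k * d := by
        have e2 : ∀ x, (univ.filter (fun y => Γ.Adj x y)).card = k := fun x => by
          rw [← hk x, ← Γ.card_neighborFinset_eq_degree, Γ.neighborFinset_eq_filter]
        rw [Fintype.sum_prod_type]
        simp [← sum_filter, e2, n, mul_assoc]
  have hii := dist_mul_degree_le hc hk v u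
  obtain ⟨p, hp⟩ := hc.exists_walk_length_eq_dist u v
  have h3 := card_sep_le_length p
  rw [hp] at h3
  refine h3.trans ?_
  set D := Γ.dist u v
  have h4 : n - 1 ≤ k * d := by
    rw [mul_assoc] at hi
    exact le_of_mul_le_mul_left hi (by omega)
  have h5 : n ≤ 2 * (k * d) := by omega
  have h6 : D * k ≤ 3 * n := by nlinarith
  refine le_of_mul_le_mul_left (a := n) ?_ (by omega)
  calc n * (D * d) ≤ 2 * (k * d) * (D * d) := by gcongr
    _ = 2 * d ^ 2 * (D * k) := by ring
    _ ≤ 2 * d ^ 2 * (3 * n) := by gcongr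
    _ = _ := by ring

end Separation

section Suborbits

variable {X : Type*} [Fintype X] [DecidableEq X] {G : Subgroup (Equiv.Perm X)}

/-- Two-transitivity of a permutation group. -/
def TwoTrans (G : Subgroup (Equiv.Perm X)) : Prop :=
  ∀ u v u' v', u ≠ v → u' ≠ v' → ∃ g ∈ G, g u = u' ∧ g v = v'

/-- The orbit of `y` under the stabiliser of `z`. -/
noncomputable def orb (G : Subgroup (Equiv.Perm X)) (z y : X) : Finset X :=
  open Classical in univ.filter (fun v => ∃ g ∈ G, g z = z ∧ g y = v)

theorem mem_orb {z y v : X} : v ∈ orb G z y ↔ ∃ g ∈ G, g z = z ∧ g y = v := by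
  simp [orb]

theorem self_mem_orb (z y : X) : y ∈ orb G z y := mem_orb.2 ⟨1, G.one_mem, rfl, rfl⟩

theorem orb_eq_of_mem {z y v : X} (h : v ∈ orb G z y) : orb G z v = orb G z y := by
  obtain ⟨g, hg, hgz, rfl⟩ := mem_orb.1 h
  have hgz' : g⁻¹ z = z := by rw [Equiv.Perm.inv_eq_iff_eq, hgz]
  ext w
  simp only [mem_orb]
  constructor
  · rintro ⟨k, hk, hkz, rfl⟩
    exact ⟨k * g, G.mul_mem hk hg, by simp [hgz, hkz], rfl⟩
  · rintro ⟨k, hk, hkz, rfl⟩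
    exact ⟨k * g⁻¹, G.mul_mem hk (G.inv_mem hg), by rw [Equiv.Perm.mul_apply, hgz', hkz], by simp⟩

theorem orb_map {a : Equiv.Perm X} (ha : a ∈ G) (z y : X) :
    orb G (a z) (a y) = (orb G z y).image a := by
  ext w
  simp only [mem_image, mem_orb]
  constructor
  · rintro ⟨g, hg, hgz, rfl⟩
    refine ⟨a⁻¹ (g (a y)), ⟨a⁻¹ * g * a, G.mul_mem (G.mul_mem (G.inv_mem ha) hg) ha, ?_, rfl⟩,
      by simp⟩
    simp [hgz]
  · rintro ⟨_, ⟨g, hg, hgz, rfl⟩, rfl⟩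
    refine ⟨a * g * a⁻¹, G.mul_mem (G.mul_mem ha hg) (G.inv_mem ha), ?_, ?_⟩
    · simp [hgz]
    · simp

theorem card_orb_map {a : Equiv.Perm X} (ha : a ∈ G) (z y : X) :
    (orb G (a z) (a y)).card = (orb G z y).card := by
  rw [orb_map ha, card_image_of_injective _ a.injective]

/-- The stabiliser orbit of `y` covers more than half of the points. -/
def Big (G : Subgroup (Equiv.Perm X)) (z y : X) : Prop :=
  Fintype.card X < 2 * (orb G z y).card

theorem big_map {a : Equiv.Perm X} (ha : a ∈ G) (z y : X) : Big G (a z) (a y) ↔ Big G z y := by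
  simp only [Big, card_orb_map ha]

theorem mem_orb_of_big {z y v : X} (hy : Big G z y) (hv : Big G z v) : v ∈ orb G z y := by
  have h1 : ¬ Disjoint (orb G z y) (orb G z v) := by
    intro hd
    have := card_le_univ (orb G z y ∪ orb G z v)
    rw [card_union_of_disjoint hd] at this
    simp only [Big] at hy hv
    omega
  obtain ⟨w, hw1, hw2⟩ := not_disjoint_iff.1 h1
  rw [← orb_eq_of_mem hw1, orb_eq_of_mem hw2]
  exact self_mem_orb z v

theorem not_big_self (hn : 2 ≤ Fintype.card X) (z : X) : ¬ Big G z z := by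
  have : orb G z z = {z} := by
    ext w
    simp only [mem_orb, mem_singleton]
    constructor
    · rintro ⟨g, -, h1, h2⟩
      rw [← h2, h1]
    · rintro rfl
      exact ⟨1, G.one_mem, rfl, rfl⟩
  simp only [Big, this, card_singleton]
  omega

theorem mem_orb_iff_big {z y : X} (hy : Big G z y) (v : X) : v ∈ orb G z y ↔ Big G z v := by
  refine ⟨fun h => ?_, fun h => mem_orb_of_big hy h⟩
  rw [Big, orb_eq_of_mem h]
  exact hy

theorem big_symm (hG : ∀ x y : X, ∃ g ∈ G, g x = y) {z y : X} (h : Big G z y) : Big G y z := by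
  classical
  set n := Fintype.card X
  have hex : ∀ z', ∃ y', Big G z' y' := by
    intro z'
    obtain ⟨g, hg, rfl⟩ := hG z z'
    exact ⟨g y, (big_map hg z y).2 h⟩
  have hrow : ∀ z', n < 2 * (univ.filter (fun v => Big G z' v)).card := by
    intro z'
    obtain ⟨y', hy'⟩ := hex z'
    have : univ.filter (fun v => Big G z' v) = orb G z' y' := by
      ext v
      simp [mem_orb_iff_big hy' v]
    rw [this]
    exact hy'
  have hn : 0 < n := Fintype.card_pos_iff.2 ⟨z⟩
  let A : Finset (X × X) := univ.filter (fun p => Big G p.1 p.2)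
  let B : Finset (X × X) := univ.filter (fun p => Big G p.2 p.1)
  have hA : n * n < 2 * A.card := by
    have : A.card = ∑ z', (univ.filter (fun v => Big G z' v)).card := by
      simp only [A, card_filter]
      rw [Fintype.sum_prod_type]
    rw [this, mul_sum]
    calc n * n = ∑ z' : X, n := by simp [n]
      _ < _ := sum_lt_sum_of_nonempty ⟨z, mem_univ z⟩ fun z' _ => hrow z'
  have hB : B.card = A.card := by
    refine card_bij (fun p _ => (p.2, p.1)) ?_ ?_ ?_
    · intro p hp; simpa [A, B] using hp
    · rintro ⟨a, b⟩ _ ⟨c, d⟩ _ h; simp at h; simp [h]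
    · rintro ⟨a, b⟩ hp; exact ⟨(b, a), by simpa [A, B] using hp, rfl⟩
  have hAB : ¬ Disjoint A B := by
    intro hd
    have := card_le_univ (A ∪ B)
    rw [card_union_of_disjoint hd, Fintype.card_prod] at this
    change _ ≤ n * n at this
    omega
  obtain ⟨⟨z₀, y₀⟩, h1, h2⟩ := not_disjoint_iff.1 hAB
  simp only [A, B, mem_filter, mem_univ, true_and] at h1 h2
  obtain ⟨g, hg, hgz⟩ := hG z z₀
  have h3 : Big G z₀ (g y) := by rw [← hgz]; exact (big_map hg z y).2 h
  obtain ⟨k, hk, hkz, hky⟩ := mem_orb.1 (mem_orb_of_big h3 h1)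
  have e1 : (k * g) z = z₀ := by rw [Equiv.Perm.mul_apply, hgz, hkz]
  have e2 : (k * g) y = y₀ := hky
  rw [← big_map (G.mul_mem hk hg), e1, e2]
  exact h2

/-- In a primitive group that is not 2-transitive, any two points are separated by many points. -/
theorem lt_card_sep (hG : IsPrimitiveSubgroup G) (h2 : ¬ TwoTrans G) {d : ℕ} (hd : 1 ≤ d)
    (hn : 42 * d ^ 4 < Fintype.card X) {x y : X} (hxy : x ≠ y) : d < (sep G x y).card := by
  classical
  by_contra! hcon
  have hall := card_sep_le hG hxy hcon
  have htr := hG.transitive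
  set n := Fintype.card X with hnd
  obtain ⟨ρ, hρ⟩ : ∃ ρ, ρ = 6 * d ^ 2 := ⟨_, rfl⟩
  have hd2 : 1 ≤ d ^ 2 := Nat.one_le_pow _ _ hd
  have hd4 : d ^ 4 = d ^ 2 * d ^ 2 := by ring
  have hρn : 2 * ρ < n := by nlinarith
  have hρ2 : ρ * ρ + ρ < n := by nlinarith
  rw [← hρ] at hall
  obtain ⟨z, -, hz⟩ : ∃ z ∈ (univ : Finset X), (univ.filter (fun v => z ∈ sep G x v)).card ≤ ρ := by
    refine exists_le_of_sum_le ⟨x, mem_univ x⟩ ?_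
    simp_rw [card_filter]
    rw [sum_comm]
    refine sum_le_sum fun v _ => ?_
    rw [← card_filter]
    simpa using hall x v
  have horb : n ≤ (orb G z x).card + ρ := by
    have h1 : (univ : Finset X) ⊆ orb G z x ∪ univ.filter (fun v => z ∈ sep G x v) := by
      intro v _
      simp only [mem_union, mem_filter, mem_univ, true_and, mem_orb, mem_sep]
      by_contra! hc
      obtain ⟨g, hg, hgz, hgx⟩ := hc.2
      exact hc.1 g hg hgz hgx
    have h2 := (card_le_card h1).trans (card_union_le _ _)
    rw [card_univ] at h2
    omega
  have hbig : Big G z x := by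
    simp only [Big]
    omega
  have horb' : ∀ z' y', Big G z' y' → n ≤ (orb G z' y').card + ρ := by
    intro z' y' h
    obtain ⟨g, hg, rfl⟩ := htr z z'
    rw [← orb_eq_of_mem (mem_orb_of_big h ((big_map hg z x).2 hbig)), card_orb_map hg]
    exact horb
  have hNb : ∀ z', (univ.filter (fun v => ¬ Big G z' v)).card ≤ ρ := by
    intro z'
    obtain ⟨g, hg, rfl⟩ := htr z z'
    have hb := (big_map hg z x).2 hbig
    have h1 := card_filter_add_card_filter_not (s := (univ : Finset X)) (fun v => Big G (g z) v)
    have h2 : univ.filter (fun v => Big G (g z) v) = orb G (g z) (g x) := by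
      ext v
      simp [mem_orb_iff_big hb v]
    have h3 := horb' _ _ hb
    rw [h2, card_univ] at h1
    omega
  obtain ⟨a, b, hab, hnab⟩ : ∃ a b, a ≠ b ∧ ¬ Big G a b := by
    by_contra! hc
    refine h2 fun u v u' v' huv huv' => ?_
    obtain ⟨g, hg, rfl⟩ := htr u u'
    have hgv : g u ≠ g v := fun h => huv (g.injective h)
    obtain ⟨k, hk, hku, hkv⟩ := mem_orb.1 (mem_orb_of_big (hc _ _ hgv) (hc _ _ huv'))
    exact ⟨k * g, G.mul_mem hk hg, hku, hkv⟩
  have hgen := hG.eqvGen (fun a b => ¬ Big G a b) (fun g hg u v h => by rwa [big_map hg]) hab hnab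
  obtain ⟨z₁, w, y₁, h1, h2', h3⟩ : ∃ z₁ w y₁, ¬ Big G z₁ w ∧ ¬ Big G w y₁ ∧ Big G z₁ y₁ := by
    by_contra! hc
    have : ∀ u v, Relation.EqvGen (fun a b => ¬ Big G a b) u v → ¬ Big G u v := by
      intro u v h
      induction h with
      | rel u v h => exact h
      | refl u => exact not_big_self (by omega) u
      | symm u v _ ih => exact fun h => ih (big_symm htr h)
      | trans u v w _ _ ih1 ih2 => exact hc u v w ih1 ih2
    exact this z x (hgen z x) hbig
  have hsub : orb G z₁ y₁ ⊆ (univ.filter (fun v => ¬ Big G z₁ v)).biUnion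
      (fun w => univ.filter (fun v => ¬ Big G w v)) := by
    intro v hv
    obtain ⟨g, hg, hgz, rfl⟩ := mem_orb.1 hv
    refine mem_biUnion.2 ⟨g w, ?_, ?_⟩
    · simp only [mem_filter, mem_univ, true_and]
      rw [← hgz, big_map hg]
      exact h1
    · simp only [mem_filter, mem_univ, true_and]
      rw [big_map hg]
      exact h2'
  have h4 : (orb G z₁ y₁).card ≤ ρ * ρ := by
    refine (card_le_card hsub).trans (card_biUnion_le.trans ?_)
    refine (sum_le_sum fun w _ => hNb w).trans ?_
    rw [sum_const, smul_eq_mul]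
    exact Nat.mul_le_mul_right _ (hNb z₁)
  have h5 := horb' _ _ h3
  omega

end Suborbits

section Covering

theorem two_mul_pred_pow_le (m : ℕ) (hm : 1 ≤ m) : 2 * (m - 1) ^ m ≤ m ^ m := by
  obtain ⟨k, rfl⟩ : ∃ k, m = k + 1 := ⟨m - 1, by omega⟩
  have h := pow_add_mul_le_add_pow (a := k) (b := 1) (by omega) (by omega) (k + 1)
  rw [Nat.add_sub_cancel]
  refine le_trans ?_ h
  have e : k ^ (k + 1) = k ^ k * k := pow_succ _ _
  simp only [Nat.add_sub_cancel, mul_one, Nat.cast_add, Nat.cast_one, Nat.cast_id]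
  nlinarith [Nat.zero_le (k ^ k)]

/-- Most sequences hit every member of a family of dense sets. -/
theorem card_uncovered_mul_le {I J : Type*} [Fintype I] [DecidableEq I] (𝒥 : Finset J)
    (P : J → Finset I) (m s : ℕ) (hm : 1 ≤ m) (hP : ∀ j ∈ 𝒥, Fintype.card I ≤ m * (P j).card) :
    (univ.filter (fun f : Fin (m * s) → I => ∃ j ∈ 𝒥, ∀ k, f k ∉ P j)).card * 2 ^ s
      ≤ 𝒥.card * Fintype.card I ^ (m * s) := by
  classical
  have h1 : univ.filter (fun f : Fin (m * s) → I => ∃ j ∈ 𝒥, ∀ k, f k ∉ P j) ⊆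
      𝒥.biUnion (fun j => Fintype.piFinset (fun _ : Fin (m * s) => (P j)ᶜ)) := by
    intro f hf
    simpa using hf
  have h2 : ∀ j ∈ 𝒥, (P j)ᶜ.card ^ (m * s) * 2 ^ s ≤ Fintype.card I ^ (m * s) := by
    intro j hj
    have h3 : m * (P j)ᶜ.card ≤ (m - 1) * Fintype.card I := by
      have h4 := hP j hj
      have h5 := card_add_card_compl (P j)
      obtain ⟨k, rfl⟩ : ∃ k, m = k + 1 := ⟨m - 1, by omega⟩
      rw [Nat.add_sub_cancel]
      nlinarith
    have h4 : 2 ^ s * (m - 1) ^ (m * s) ≤ m ^ (m * s) := by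
      rw [pow_mul, pow_mul, ← mul_pow]
      exact Nat.pow_le_pow_left (two_mul_pred_pow_le m hm) s
    refine le_of_mul_le_mul_left ?_ (show 0 < m ^ (m * s) by positivity)
    calc m ^ (m * s) * ((P j)ᶜ.card ^ (m * s) * 2 ^ s)
        = 2 ^ s * (m * (P j)ᶜ.card) ^ (m * s) := by rw [mul_pow]; ring
      _ ≤ 2 ^ s * ((m - 1) * Fintype.card I) ^ (m * s) := by gcongr
      _ = (2 ^ s * (m - 1) ^ (m * s)) * Fintype.card I ^ (m * s) := by rw [mul_pow]; ring
      _ ≤ m ^ (m * s) * Fintype.card I ^ (m * s) := by gcongr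
  calc _ ≤ (∑ j ∈ 𝒥, (P j)ᶜ.card ^ (m * s)) * 2 ^ s := by
        gcongr
        refine (card_le_card h1).trans (card_biUnion_le.trans (le_of_eq ?_))
        exact sum_congr rfl fun j _ => by simp
    _ = ∑ j ∈ 𝒥, (P j)ᶜ.card ^ (m * s) * 2 ^ s := by rw [sum_mul]
    _ ≤ ∑ j ∈ 𝒥, Fintype.card I ^ (m * s) := sum_le_sum h2
    _ = _ := by simp

theorem card_mul_card_eval_mem {X : Type*} [Fintype X] [DecidableEq X] {r : ℕ} (k : Fin r)
    (S : Finset X) :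
    Fintype.card X * (univ.filter (fun f : Fin r → X => f k ∈ S)).card
      = S.card * Fintype.card X ^ r := by
  have h1 : univ.filter (fun f : Fin r → X => f k ∈ S)
      = Fintype.piFinset (fun j => if j = k then S else univ) := by
    ext f
    simp only [mem_filter, mem_univ, true_and, Fintype.mem_piFinset]
    constructor
    · intro h j
      split_ifs with hj
      · rwa [hj]
      · exact mem_univ _
    · intro h
      simpa using h k
  rw [h1, Fintype.card_piFinset, ← mul_prod_erase univ _ (mem_univ k), if_pos rfl,
    prod_congr rfl (g := fun _ => Fintype.card X)
      (fun j hj => by rw [if_neg (ne_of_mem_erase hj), card_univ]), prod_const,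
    card_erase_of_mem (mem_univ k), card_univ, Fintype.card_fin]
  obtain ⟨r, rfl⟩ : ∃ s, r = s + 1 := ⟨r - 1, by have := k.2; omega⟩
  rw [Nat.add_sub_cancel, pow_succ]
  ring

/-- Most sequences rarely hit a small set. -/
theorem card_often_hit_mul_le {X : Type*} [Fintype X] [DecidableEq X] (r t σ c : ℕ)
    (S : Finset X) (hr : 0 < r) (hσ : 0 < σ)
    (hS : S.card ≤ σ) (ht : c * (r * σ) ≤ (t + 1) * Fintype.card X) :
    (univ.filter (fun f : Fin r → X => t < (univ.filter (fun k => f k ∈ S)).card)).card * c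
      ≤ Fintype.card X ^ r := by
  set B := univ.filter (fun f : Fin r → X => t < (univ.filter (fun k => f k ∈ S)).card)
  have h1 : Fintype.card X * (B.card * (t + 1)) ≤ r * σ * Fintype.card X ^ r := by
    calc Fintype.card X * (B.card * (t + 1))
        ≤ Fintype.card X * ∑ f : Fin r → X, (univ.filter (fun k => f k ∈ S)).card := by
          gcongr
          rw [← smul_eq_mul]
          refine (card_nsmul_le_sum B _ _ fun f hf => ?_).trans
            (sum_le_sum_of_subset (subset_univ B))
          exact (mem_filter.1 hf).2
      _ = ∑ k : Fin r, Fintype.card X * (univ.filter (fun f : Fin r → X => f k ∈ S)).card := by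
          rw [← mul_sum]
          congr 1
          simp_rw [card_filter]
          rw [sum_comm]
      _ = r * (S.card * Fintype.card X ^ r) := by
          simp [card_mul_card_eval_mem]
      _ ≤ r * (σ * Fintype.card X ^ r) := by gcongr
      _ = _ := by ring
  refine le_of_mul_le_mul_left ?_ (show 0 < r * σ by positivity)
  calc r * σ * (B.card * c) = B.card * (c * (r * σ)) := by ring
    _ ≤ B.card * ((t + 1) * Fintype.card X) := by gcongr
    _ = Fintype.card X * (B.card * (t + 1)) := by ring
    _ ≤ _ := h1

end Covering

section Separated

variable {X : Type*} [Fintype X] [DecidableEq X] {G : Subgroup (Equiv.Perm X)}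

theorem sep_subset_support {a : Equiv.Perm X} (ha : a ∈ G) (x : X) :
    sep G x (a x) ⊆ a.support := by
  intro z hz
  rw [Equiv.Perm.mem_support]
  exact fun h => mem_sep.1 hz a ha h rfl

theorem eq_of_agree_on_base {ι : Type*} {f : ι → X}
    (hf : ∀ x y, x ≠ y → ∃ k, f k ∈ sep G x y) {a b : Equiv.Perm X} (ha : a ∈ G) (hb : b ∈ G)
    (hab : ∀ k, a (f k) = b (f k)) : a = b := by
  ext x
  by_contra hne
  have hc : b⁻¹ * a ∈ G := G.mul_mem (G.inv_mem hb) ha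
  have hx : x ≠ (b⁻¹ * a) x := by
    intro h
    apply hne
    rw [Equiv.Perm.mul_apply, Equiv.Perm.eq_inv_iff_eq] at h
    exact h.symm
  obtain ⟨k, hk⟩ := hf _ _ hx
  refine mem_sep.1 hk _ hc ?_ rfl
  rw [Equiv.Perm.mul_apply, hab, Equiv.Perm.inv_eq_iff_eq]

theorem card_small_support_le {m d L σ t : ℕ} (hn : Fintype.card X ≤ 2 ^ L) (hm : 1 ≤ m)
    (hd : Fintype.card X ≤ m * d) (hsep : ∀ x y, x ≠ y → d ≤ (sep G x y).card)
    (hX : 0 < Fintype.card X) (hσ : 0 < σ)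
    (ht : 4 * (m * (2 * L + 2) * σ) ≤ (t + 1) * Fintype.card X) :
    ((elems G).filter (fun a => a.support.card ≤ σ)).card
      ≤ 2 * (m * (2 * L + 2) * Fintype.card X) ^ t := by
  classical
  set N := (elems G).filter (fun a => a.support.card ≤ σ) with hN
  obtain ⟨r, hr⟩ : ∃ r, r = m * (2 * L + 2) := ⟨_, rfl⟩
  have hr0 : 0 < r := by rw [hr]; positivity
  let hit : Equiv.Perm X → (Fin r → X) → ℕ := fun a f =>
    (univ.filter (fun k => f k ∈ a.support)).card
  let base : (Fin r → X) → Prop := fun f => ∀ x y, x ≠ y → ∃ k, f k ∈ sep G x y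
  have hbad : (univ.filter (fun f => ¬ base f)).card * 4 ≤ Fintype.card X ^ r := by
    have h1 := card_uncovered_mul_le (I := X) (univ : Finset X).offDiag
      (fun p => sep G p.1 p.2) m (2 * L + 2) hm (fun p hp => hd.trans
        (Nat.mul_le_mul_left _ (hsep _ _ (by simpa using hp))))
    rw [← hr] at h1
    have h2 : (univ : Finset X).offDiag.card ≤ 2 ^ (2 * L) := by
      rw [offDiag_card, card_univ, mul_comm 2 L, pow_mul, sq]
      exact (Nat.sub_le _ _).trans (Nat.mul_le_mul hn hn)
    refine le_of_mul_le_mul_left ?_ (show 0 < 2 ^ (2 * L) by positivity)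
    calc 2 ^ (2 * L) * ((univ.filter (fun f => ¬ base f)).card * 4)
        = (univ.filter (fun f => ¬ base f)).card * 2 ^ (2 * L + 2) := by rw [pow_add]; ring
      _ ≤ (univ : Finset X).offDiag.card * Fintype.card X ^ r := by
          refine le_trans (Nat.mul_le_mul_right _ (card_le_card fun f hf => ?_)) h1
          simp only [mem_filter, mem_univ, true_and, base, not_forall, not_exists] at hf
          obtain ⟨x, y, hxy, h⟩ := hf
          simp only [mem_filter, mem_univ, true_and]
          exact ⟨(x, y), by simpa using hxy, h⟩
      _ ≤ _ := by gcongr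
  have hgood : ∀ a ∈ N, Fintype.card X ^ r ≤
      2 * (univ.filter (fun f => base f ∧ hit a f ≤ t)).card := by
    intro a ha
    have h1 := card_often_hit_mul_le r t σ 4 a.support hr0 hσ (mem_filter.1 ha).2 (by rwa [hr])
    have h2 : (univ : Finset (Fin r → X)).card = Fintype.card X ^ r := by simp
    have h3 : (univ : Finset (Fin r → X)) ⊆ univ.filter (fun f => base f ∧ hit a f ≤ t) ∪
        (univ.filter (fun f => ¬ base f) ∪ univ.filter (fun f => t < hit a f)) := by
      intro f _
      simp only [mem_union, mem_filter, mem_univ, true_and]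
      by_cases hb : base f
      · rcases le_or_gt (hit a f) t with h | h
        · exact Or.inl ⟨hb, h⟩
        · exact Or.inr (Or.inr h)
      · exact Or.inr (Or.inl hb)
    have h4 := (card_le_card h3).trans (card_union_le _ _)
    have h5 := card_union_le (univ.filter (fun f => ¬ base f)) (univ.filter (fun f => t < hit a f))
    change (univ.filter (fun f => t < hit a f)).card * 4 ≤ _ at h1
    omega
  obtain ⟨f, hf⟩ : ∃ f, base f ∧ N.card ≤ 2 * (N.filter (fun a => hit a f ≤ t)).card := by
    by_contra! hcon
    have h1 : N.card * Fintype.card X ^ r ≤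
        ∑ f : Fin r → X, 2 * (N.filter (fun a => base f ∧ hit a f ≤ t)).card := by
      rw [← mul_sum]
      have e : ∑ f : Fin r → X, (N.filter (fun a => base f ∧ hit a f ≤ t)).card
          = ∑ a ∈ N, (univ.filter (fun f => base f ∧ hit a f ≤ t)).card := by
        simp_rw [card_filter]
        rw [sum_comm]
      rw [e, mul_sum, ← smul_eq_mul]
      exact card_nsmul_le_sum N _ _ hgood
    have hNpos : 0 < N.card := card_pos.2 ⟨1, by simp [hN, G.one_mem]⟩
    have h2 : ∑ f : Fin r → X, 2 * (N.filter (fun a => base f ∧ hit a f ≤ t)).card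
        < ∑ f : Fin r → X, N.card := by
      have : Nonempty X := Fintype.card_pos_iff.1 hX
      refine sum_lt_sum_of_nonempty univ_nonempty fun f _ => ?_
      by_cases hb : base f
      · simpa [hb] using hcon f hb
      · simpa [hb] using hNpos
    simp only [sum_const, card_univ, Fintype.card_fun, Fintype.card_fin, smul_eq_mul] at h2
    rw [mul_comm] at h2
    omega
  refine hf.2.trans (Nat.mul_le_mul_left _ ?_)
  have : Nonempty (Fin r) := ⟨⟨0, hr0⟩⟩
  have hball := card_hamming_ball_le f t
  rw [Fintype.card_fin] at hball
  rw [← hr]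
  refine le_trans ?_ hball
  refine card_le_card_of_injOn (fun a k => a (f k)) (fun a ha => ?_) ?_
  · simp only [coe_filter, Set.mem_ofPred_eq] at ha
    simpa [hit] using ha.2
  · intro a ha b hb hab
    simp only [hN, coe_filter, mem_filter, mem_elems, Set.mem_ofPred_eq] at ha hb
    exact eq_of_agree_on_base hf.1 ha.1.1 hb.1.1 (congrFun hab)

/-- A primitive group that is not two-transitive is thin. -/
theorem thin_of_not_twoTrans (hG : IsPrimitiveSubgroup G) (h2 : ¬ TwoTrans G) {L : ℕ}
    (hL : 64 ≤ L) (hn : Fintype.card X ≤ 2 ^ L) (hn' : L ^ 100 ≤ Fintype.card X) :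
    Thin G (L ^ 20) := by
  have hX : 0 < Fintype.card X := lt_of_lt_of_le (by positivity) hn'
  have hd : ∀ x y : X, x ≠ y → L ^ 24 < (sep G x y).card := fun x y hxy => by
    refine lt_card_sep hG h2 (Nat.one_le_pow _ _ (by omega)) ?_ hxy
    calc 42 * (L ^ 24) ^ 4 < L ^ 4 * (L ^ 24) ^ 4 := by
          gcongr
          calc 42 < 64 ^ 4 := by norm_num
            _ ≤ L ^ 4 := by gcongr
      _ = L ^ 100 := by ring
      _ ≤ _ := hn'
  have hmin : ∀ a ∈ G, a ≠ 1 → L ^ 24 < a.support.card := by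
    intro a ha h1
    obtain ⟨x, hx⟩ : ∃ x, a x ≠ x := by
      by_contra! h
      exact h1 (Equiv.ext h)
    exact (hd _ _ (Ne.symm hx)).trans_le (card_le_card (sep_subset_support ha x))
  intro σ
  rcases lt_or_ge σ (L ^ 24) with hσ | hσ
  · refine (card_le_one.2 fun a ha b hb => ?_).trans (Nat.one_le_two_pow)
    have key : ∀ a ∈ (elems G).filter (fun a => a.support.card ≤ σ), a = 1 := by
      intro a ha
      by_contra h1
      have h3 := hmin a (mem_elems.1 (mem_filter.1 ha).1) h1
      have h4 := (mem_filter.1 ha).2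
      omega
    rw [key a ha, key b hb]
  obtain ⟨d, hdd⟩ : ∃ d, d = L ^ 24 := ⟨_, rfl⟩
  obtain ⟨n, hnn⟩ : ∃ n, n = Fintype.card X := ⟨_, rfl⟩
  obtain ⟨q, hq⟩ : ∃ q, q = L ^ 20 := ⟨_, rfl⟩
  have hdq : d = L ^ 4 * q := by rw [hdd, hq]; ring
  have hd0 : 0 < d := by rw [hdd]; positivity
  have hdn : d ≤ n := by
    rw [hdd, hnn]; exact (Nat.pow_le_pow_right (by omega) (by omega)).trans hn'
  obtain ⟨m, hm⟩ : ∃ m, m = n / d + 1 := ⟨_, rfl⟩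
  obtain ⟨t, ht⟩ : ∃ t, t = 4 * (m * (2 * L + 2) * σ) / n := ⟨_, rfl⟩
  have hmd : n ≤ m * d := by
    rw [hm, mul_comm]; exact (Nat.lt_mul_div_succ n hd0).le
  have hmd2 : m * d ≤ 2 * n := by
    rw [hm, add_mul, one_mul]
    have := Nat.div_mul_le_self n d
    omega
  have h1 := card_small_support_le (G := G) (m := m) (d := d) (L := L) (σ := σ) (t := t) hn
    (by rw [hm]; exact Nat.le_add_left 1 _) (hnn ▸ hmd) (fun x y hxy => by rw [hdd]; exact (hd x y hxy).le) hX
    (lt_of_lt_of_le (by positivity) hσ) (by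
      rw [ht, ← hnn, mul_comm _ n]
      exact (Nat.lt_mul_div_succ _ (by omega)).le)
  rw [← hnn] at h1
  have hn2 : n ≤ 2 ^ L := hnn ▸ hn
  have htn : t * n ≤ 4 * (m * (2 * L + 2) * σ) := by rw [ht]; exact Nat.div_mul_le_self _ _
  have hrn : m * (2 * L + 2) ≤ n := by
    have h3 : 2 * (2 * L + 2) ≤ d := by
      calc 2 * (2 * L + 2) ≤ L ^ 2 := by nlinarith
        _ ≤ L ^ 24 := Nat.pow_le_pow_right (by omega) (by omega)
        _ = d := hdd.symm
    have : 2 * (m * (2 * L + 2)) ≤ 2 * n := by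
      calc 2 * (m * (2 * L + 2)) = m * (2 * (2 * L + 2)) := by ring
        _ ≤ m * d := by gcongr
        _ ≤ 2 * n := hmd2
    omega
  have htd : t * d ≤ 32 * L * σ := by
    refine le_of_mul_le_mul_left ?_ (show 0 < n by omega)
    calc n * (t * d) = (t * n) * d := by ring
      _ ≤ 4 * (m * (2 * L + 2) * σ) * d := by gcongr
      _ = 4 * (2 * L + 2) * σ * (m * d) := by ring
      _ ≤ 4 * (2 * L + 2) * σ * (2 * n) := by gcongr
      _ = n * (16 * (L + 1) * σ) := by ring
      _ ≤ n * (16 * (2 * L) * σ) := by gcongr; omega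
      _ = _ := by ring
  have hfin : 1 + 2 * L * t ≤ σ / q := by
    rw [Nat.le_div_iff_mul_le (by rw [hq]; positivity)]
    have h3 : 2 * q ≤ σ := by
      calc 2 * q ≤ L ^ 4 * q := by
            gcongr
            calc 2 ≤ 64 ^ 4 := by norm_num
              _ ≤ L ^ 4 := by gcongr
        _ = d := hdq.symm
        _ ≤ σ := hdd ▸ hσ
    have h4 : 4 * L * t * q ≤ σ := by
      refine le_of_mul_le_mul_left ?_ (show 0 < L ^ 3 by positivity)
      calc L ^ 3 * (4 * L * t * q) = 4 * (t * d) := by rw [hdq]; ring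
        _ ≤ 4 * (32 * L * σ) := by gcongr
        _ = 128 * (L * σ) := by ring
        _ ≤ L ^ 2 * (L * σ) := by gcongr; nlinarith
        _ = _ := by ring
    nlinarith
  calc _ ≤ 2 * (m * (2 * L + 2) * n) ^ t := h1
    _ ≤ 2 * (2 ^ L * 2 ^ L) ^ t := by
        gcongr
        exact hrn.trans hn2
    _ = 2 ^ (1 + 2 * L * t) := by rw [← pow_add, ← pow_mul, pow_add]; ring_nf
    _ ≤ 2 ^ (σ / q) := Nat.pow_le_pow_right (by omega) hfin
    _ = _ := by rw [hq]

end Separated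

section TwoTransitive

variable {X : Type*} [Fintype X] [DecidableEq X] {G : Subgroup (Equiv.Perm X)}

theorem card_transport₂ (h2 : TwoTrans G) {u v u' v' : X} (huv : u ≠ v) (huv' : u' ≠ v') :
    (univ : Finset X).offDiag.card * ((elems G).filter (fun g => g u = u' ∧ g v = v')).card
      = (elems G).card := by
  have h1 : ∀ p ∈ (univ : Finset X).offDiag,
      ((elems G).filter (fun g => (g u, g v) = p)).card
        = ((elems G).filter (fun g => g u = u' ∧ g v = v')).card := by
    rintro ⟨a, b⟩ hp
    have hab : a ≠ b := by simpa using hp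
    obtain ⟨k, hk, hka, hkb⟩ := h2 a b u' v' hab huv'
    refine card_bij (fun g _ => k * g) ?_ ?_ ?_
    · intro g hg
      simp only [mem_filter, mem_elems, Prod.mk.injEq] at hg ⊢
      refine ⟨G.mul_mem hk hg.1, ?_, ?_⟩
      · rw [Equiv.Perm.mul_apply, hg.2.1, hka]
      · rw [Equiv.Perm.mul_apply, hg.2.2, hkb]
    · intro a _ b _ h
      exact mul_left_cancel h
    · intro g hg
      simp only [mem_filter, mem_elems] at hg
      refine ⟨k⁻¹ * g, ?_, by simp⟩
      simp only [mem_filter, mem_elems, Prod.mk.injEq, Equiv.Perm.mul_apply,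
        Equiv.Perm.inv_eq_iff_eq]
      exact ⟨G.mul_mem (G.inv_mem hk) hg.1, by rw [hg.2.1, hka], by rw [hg.2.2, hkb]⟩
  have hmaps : ∀ g ∈ elems G, (g u, g v) ∈ (univ : Finset X).offDiag := fun g _ => by
    simpa using huv
  rw [card_eq_sum_card_fiberwise hmaps, sum_congr rfl h1, sum_const, smul_eq_mul]

theorem sum_card_filter_map₂ (h2 : TwoTrans G) (A B : Finset (X × X))
    (hA : ∀ p ∈ A, p.1 ≠ p.2) (hB : ∀ p ∈ B, p.1 ≠ p.2) :
    (univ : Finset X).offDiag.card *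
        ∑ g ∈ elems G, (A.filter (fun p => (g p.1, g p.2) ∈ B)).card
      = A.card * B.card * (elems G).card := by
  have h1 : ∀ g : Equiv.Perm X, (A.filter (fun p => (g p.1, g p.2) ∈ B)).card
      = ∑ p ∈ A, ∑ s ∈ B, if g p.1 = s.1 ∧ g p.2 = s.2 then 1 else 0 := by
    intro g
    rw [card_filter]
    refine sum_congr rfl fun p _ => ?_
    have : ∀ s : X × X, (if g p.1 = s.1 ∧ g p.2 = s.2 then 1 else 0)
        = if (g p.1, g p.2) = s then 1 else 0 := fun s => by simp [Prod.ext_iff]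
    simp_rw [this, sum_ite_eq]
  simp_rw [h1]
  rw [sum_comm, mul_sum]
  calc _ = ∑ p ∈ A, B.card * (elems G).card := by
        refine sum_congr rfl fun p hp => ?_
        rw [sum_comm, mul_sum]
        calc _ = ∑ s ∈ B, (elems G).card := by
              refine sum_congr rfl fun s hs => ?_
              rw [← card_filter, card_transport₂ h2 (hA p hp) (hB s hs)]
          _ = _ := by simp
    _ = _ := by rw [sum_const, smul_eq_mul]; ring

theorem support_commutator_subset (k l : Equiv.Perm X) :
    (k * l * k⁻¹ * l⁻¹).support ⊆ (k.support ∩ l.support) ∪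
      ((k.support ∩ l.support).image k ∪ (k.support ∩ l.support).image l) := by
  intro x hx
  rw [Equiv.Perm.mem_support] at hx
  by_contra hcon
  simp only [mem_union, mem_image, not_or, not_exists, not_and] at hcon
  obtain ⟨hI, hk, hl⟩ := hcon
  have hk' : k⁻¹ x ∉ k.support ∩ l.support := fun h => hk _ h (by simp)
  have hl' : l⁻¹ x ∉ k.support ∩ l.support := fun h => hl _ h (by simp)
  have fk : ∀ y, y ∉ k.support → k⁻¹ y = y := fun y hy => by
    rw [Equiv.Perm.inv_eq_iff_eq, Equiv.Perm.notMem_support.1 hy]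
  have fl : ∀ y, y ∉ l.support → l⁻¹ y = y := fun y hy => by
    rw [Equiv.Perm.inv_eq_iff_eq, Equiv.Perm.notMem_support.1 hy]
  have key : k⁻¹ (l⁻¹ x) = l⁻¹ (k⁻¹ x) := by
    by_cases h1 : x ∈ k.support
    · have h2 : x ∉ l.support := fun h => hI (mem_inter.2 ⟨h1, h⟩)
      have h3 : k⁻¹ x ∈ k.support := by
        rw [← Equiv.Perm.support_inv] at h1 ⊢
        exact Equiv.Perm.apply_mem_support.2 h1
      rw [fl _ h2, fl _ fun h => hk' (mem_inter.2 ⟨h3, h⟩)]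
    · rw [fk x h1]
      by_cases h2 : x ∈ l.support
      · have h3 : l⁻¹ x ∈ l.support := by
          rw [← Equiv.Perm.support_inv] at h2 ⊢
          exact Equiv.Perm.apply_mem_support.2 h2
        exact fk _ fun h => hl' (mem_inter.2 ⟨h, h3⟩)
      · rw [fl x h2, fk x h1]
  apply hx
  simp only [Equiv.Perm.mul_apply, key]
  simp

theorem card_support_le_three_mul (k : Equiv.Perm X)
    (hmin : ∀ a ∈ G, a ≠ 1 → k.support.card ≤ a.support.card) (hk : k ∈ G) {g : Equiv.Perm X}
    (hg : g ∈ G) {β : X} (h2 : g β ∈ k.support) (h3 : g (k β) ∉ k.support) :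
    k.support.card ≤ 3 * (k.support.filter (fun x => g x ∈ k.support)).card := by
  obtain ⟨l, hl⟩ : ∃ l, l = g * k * g⁻¹ := ⟨_, rfl⟩
  have hlG : l ∈ G := by rw [hl]; exact G.mul_mem (G.mul_mem hg hk) (G.inv_mem hg)
  have hlg : ∀ x, l (g x) = g (k x) := fun x => by simp [hl]
  have hc : k * l * k⁻¹ * l⁻¹ ≠ 1 := by
    intro h
    have h4 : k * l = l * k := by
      have := mul_eq_one_iff_eq_inv.1 h
      rw [inv_inv] at this
      exact mul_inv_eq_iff_eq_mul.1 this
    have h5 := congrArg (fun e : Equiv.Perm X => e (g β)) h4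
    simp only [Equiv.Perm.mul_apply, hlg] at h5
    rw [Equiv.Perm.notMem_support.1 h3, ← hlg] at h5
    exact Equiv.Perm.mem_support.1 h2 (l.injective h5).symm
  have h6 := hmin _ (G.mul_mem (G.mul_mem (G.mul_mem hk hlG) (G.inv_mem hk)) (G.inv_mem hlG)) hc
  have h7 := card_le_card (support_commutator_subset k l)
  have h8 := card_union_le (k.support ∩ l.support)
    ((k.support ∩ l.support).image k ∪ (k.support ∩ l.support).image l)
  have h9 := card_union_le ((k.support ∩ l.support).image k) ((k.support ∩ l.support).image l)
  rw [card_image_of_injective _ k.injective, card_image_of_injective _ l.injective] at h9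
  have h10 : (k.support ∩ l.support).card
      ≤ (k.support.filter (fun x => g x ∈ k.support)).card := by
    rw [← card_image_of_injective (k.support.filter _) g.injective]
    refine card_le_card fun y hy => ?_
    rw [mem_inter] at hy
    obtain ⟨x, rfl⟩ := g.surjective y
    refine mem_image_of_mem _ (mem_filter.2 ⟨?_, hy.1⟩)
    have := hy.2
    rw [Equiv.Perm.mem_support, hlg] at this
    rw [Equiv.Perm.mem_support]
    exact fun h => this (by rw [h])
  omega

theorem card_support_bound (h2 : TwoTrans G) (k : Equiv.Perm X)
    (hmin : ∀ a ∈ G, a ≠ 1 → k.support.card ≤ a.support.card) (hk : k ∈ G) (hk1 : k ≠ 1) :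
    (k.support.card - 3) * (Fintype.card X - k.support.card) ≤ 3 * (k.support.card - 1) ^ 2 := by
  obtain ⟨S, hS⟩ : ∃ S, S = k.support := ⟨_, rfl⟩
  obtain ⟨m, hm⟩ : ∃ m, m = S.card := ⟨_, rfl⟩
  have hA := sum_card_filter_map₂ h2 (S.image (fun x => (x, k x))) (S ×ˢ Sᶜ)
    (by
      intro p hp
      obtain ⟨x, hx, rfl⟩ := mem_image.1 hp
      rw [hS, Equiv.Perm.mem_support] at hx
      exact hx.symm)
    (by
      intro p hp h
      rw [mem_product, h, mem_compl] at hp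
      exact hp.2 hp.1)
  have hB := sum_card_filter_map₂ h2 S.offDiag S.offDiag (fun p hp => (mem_offDiag.1 hp).2.2)
    (fun p hp => (mem_offDiag.1 hp).2.2)
  have hpt : ∀ g ∈ elems G,
      (m - 3) * ((S.image (fun x => (x, k x))).filter (fun p => (g p.1, g p.2) ∈ S ×ˢ Sᶜ)).card
        ≤ 3 * (S.offDiag.filter (fun p => (g p.1, g p.2) ∈ S.offDiag)).card := by
    intro g hg
    rcases ((S.image (fun x => (x, k x))).filter
      (fun p => (g p.1, g p.2) ∈ S ×ˢ Sᶜ)).eq_empty_or_nonempty with h0 | ⟨p, hp⟩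
    · rw [h0, card_empty, mul_zero]
      exact Nat.zero_le _
    rw [mem_filter, mem_image] at hp
    obtain ⟨⟨β, hβ, rfl⟩, hβ2⟩ := hp
    simp only [mem_product, mem_compl] at hβ2
    have h3 := card_support_le_three_mul k hmin hk (mem_elems.1 hg) (hS ▸ hβ2.1)
      (hS ▸ hβ2.2)
    rw [← hS, ← hm] at h3
    obtain ⟨W, hW⟩ : ∃ W, W = S.filter (fun x => g x ∈ S) := ⟨_, rfl⟩
    rw [← hW] at h3
    have h4 : ((S.image (fun x => (x, k x))).filter (fun p => (g p.1, g p.2) ∈ S ×ˢ Sᶜ)).card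
        ≤ W.card := by
      refine card_le_card_of_injOn Prod.fst (fun p hp => ?_) ?_
      · simp only [coe_filter, mem_image, Set.mem_ofPred_eq] at hp
        obtain ⟨⟨x, hx, rfl⟩, hx2⟩ := hp
        simp only [mem_product] at hx2
        simp [hW, hx, hx2.1]
      · intro p hp q hq hpq
        simp only [coe_filter, mem_image, Set.mem_ofPred_eq] at hp hq
        obtain ⟨⟨x, hx, rfl⟩, -⟩ := hp
        obtain ⟨⟨y, hy, rfl⟩, -⟩ := hq
        simp only at hpq
        rw [hpq]
    have h5 : S.offDiag.filter (fun p => (g p.1, g p.2) ∈ S.offDiag) = W.offDiag := by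
      ext p
      simp only [hW, mem_filter, mem_offDiag]
      constructor
      · rintro ⟨⟨a, b, c⟩, d, e, -⟩
        exact ⟨⟨a, d⟩, ⟨b, e⟩, c⟩
      · rintro ⟨⟨a, d⟩, ⟨b, e⟩, c⟩
        exact ⟨⟨a, b, c⟩, d, e, fun h => c (g.injective h)⟩
    rw [h5, offDiag_card]
    obtain ⟨w, hw⟩ : ∃ w, w = W.card := ⟨_, rfl⟩
    rw [← hw] at h3 h4 ⊢
    calc _ ≤ (3 * (w - 1)) * w := Nat.mul_le_mul (by omega) h4
      _ = 3 * (w * w - w) := by rw [mul_assoc, Nat.sub_mul, one_mul]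
  have hsum := sum_le_sum hpt
  rw [← mul_sum, ← mul_sum] at hsum
  have hcA : (S.image (fun x => (x, k x))).card = m := by
    rw [card_image_of_injective _ (fun a b h => (Prod.ext_iff.1 h).1), hm]
  have hm0 : 0 < m := by
    rw [hm, hS, card_pos, nonempty_iff_ne_empty]
    exact fun h => hk1 (Equiv.Perm.support_eq_empty_iff.1 h)
  rw [hcA, card_product, card_compl, ← hm] at hA
  rw [offDiag_card S, ← hm] at hB
  rw [← hS, ← hm]
  have hG0 := elems_card_pos G
  obtain ⟨N, hN⟩ : ∃ N, N = (univ : Finset X).offDiag.card := ⟨_, rfl⟩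
  rw [← hN] at hA hB
  have hmm : m * m - m = m * (m - 1) := by rw [Nat.mul_sub, mul_one]
  rw [hmm] at hB
  refine le_of_mul_le_mul_left ?_ (show 0 < m * m * (elems G).card by positivity)
  calc m * m * (elems G).card * ((m - 3) * (Fintype.card X - m))
      = (m - 3) * (m * (m * (Fintype.card X - m)) * (elems G).card) := by ring
    _ ≤ 3 * (m * (m - 1) * (m * (m - 1)) * (elems G).card) := by
        rw [← hA, ← hB]
        calc _ = N * ((m - 3) * _) := by ring
          _ ≤ N * (3 * _) := Nat.mul_le_mul_left _ hsum
          _ = _ := by ring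
    _ = _ := by ring

/-- A doubly transitive group without the alternating group moves a fifth of the points. -/
theorem lt_five_mul_card_support (hG : IsPrimitiveSubgroup G) (h2 : TwoTrans G)
    (hA : ¬ alternatingGroup X ≤ G) (hn : 81 < Fintype.card X) {a : Equiv.Perm X} (ha : a ∈ G)
    (ha1 : a ≠ 1) : Fintype.card X < 5 * a.support.card := by
  obtain ⟨k, hk, hmin⟩ := exists_min_image ((elems G).filter (fun g => g ≠ 1))
    (fun g => g.support.card) ⟨a, by simp [ha, ha1]⟩
  simp only [mem_filter, mem_elems, and_imp] at hk hmin
  refine lt_of_lt_of_le ?_ (Nat.mul_le_mul_left 5 (hmin a ha ha1))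
  have hp : MulAction.IsPreprimitive G X :=
    { toIsPretransitive := hG.1, isTrivialBlock_of_isBlock := fun {B} h => hG.2 B h }
  have h3 := card_support_bound h2 k (fun a => hmin a) hk.1 hk.2
  have h4 : 2 ≤ k.support.card := Equiv.Perm.two_le_card_support_of_ne_one hk.2
  have h5 : k.support.card ≠ 2 := fun h => hA (by
    rw [Equiv.Perm.subgroup_eq_top_of_isPreprimitive_of_isSwap_mem hp k
      (Equiv.Perm.card_support_eq_two.1 h) hk.1]
    exact le_top)
  have h6 : k.support.card ≠ 3 := fun h => hA
    (Equiv.Perm.alternatingGroup_le_of_isPreprimitive_of_isThreeCycle_mem hp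
      (card_support_eq_three_iff.1 h) hk.1)
  by_contra! h7
  obtain ⟨m, hm⟩ : ∃ m, k.support.card = m + 4 := ⟨k.support.card - 4, by omega⟩
  obtain ⟨n, hn'⟩ : ∃ n, Fintype.card X = n + (m + 4) := ⟨Fintype.card X - (m + 4), by omega⟩
  rw [hm, hn'] at h3 h7
  rw [hn'] at hn
  have e1 : m + 4 - 3 = m + 1 := by omega
  have e2 : m + 4 - 1 = m + 3 := by omega
  rw [e1, e2, Nat.add_sub_cancel] at h3
  have h8 : m ≤ 2 := by nlinarith
  interval_cases m <;> omega

end TwoTransitive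

section PointwiseOrbits

variable {X : Type*} [Fintype X] [DecidableEq X] {G : Subgroup (Equiv.Perm X)}

/-- The orbit of `x` under the pointwise stabiliser of `D`. -/
noncomputable def fixOrb (G : Subgroup (Equiv.Perm X)) (D : Finset X) (x : X) : Finset X :=
  open Classical in univ.filter (fun v => ∃ g ∈ G, (∀ z ∈ D, g z = z) ∧ g x = v)

theorem mem_fixOrb {D : Finset X} {x v : X} :
    v ∈ fixOrb G D x ↔ ∃ g ∈ G, (∀ z ∈ D, g z = z) ∧ g x = v := by
  simp [fixOrb]

theorem self_mem_fixOrb (D : Finset X) (x : X) : x ∈ fixOrb G D x :=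
  mem_fixOrb.2 ⟨1, G.one_mem, fun _ _ => rfl, rfl⟩

theorem mem_fixOrb_of_mem_of_mem {D : Finset X} {x y v : X} (hx : v ∈ fixOrb G D x)
    (hy : v ∈ fixOrb G D y) : y ∈ fixOrb G D x := by
  obtain ⟨a, ha, haD, hax⟩ := mem_fixOrb.1 hx
  obtain ⟨b, hb, hbD, hby⟩ := mem_fixOrb.1 hy
  refine mem_fixOrb.2 ⟨b⁻¹ * a, G.mul_mem (G.inv_mem hb) ha, fun z hz => ?_, ?_⟩
  · rw [Equiv.Perm.mul_apply, haD z hz, Equiv.Perm.inv_eq_iff_eq, hbD z hz]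
  · rw [Equiv.Perm.mul_apply, hax, Equiv.Perm.inv_eq_iff_eq, hby]

theorem fixOrb_mono {D E : Finset X} (h : D ⊆ E) (x : X) : fixOrb G E x ⊆ fixOrb G D x := by
  intro v hv
  obtain ⟨a, ha, haD, hax⟩ := mem_fixOrb.1 hv
  exact mem_fixOrb.2 ⟨a, ha, fun z hz => haD z (h hz), hax⟩

theorem fixOrb_subset_of_mem {D : Finset X} {x y : X} (h : y ∈ fixOrb G D x) :
    fixOrb G D y ⊆ fixOrb G D x := by
  intro v hv
  obtain ⟨a, ha, haD, hax⟩ := mem_fixOrb.1 hv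
  obtain ⟨b, hb, hbD, hby⟩ := mem_fixOrb.1 h
  exact mem_fixOrb.2 ⟨a * b, G.mul_mem ha hb, fun z hz => by
    rw [Equiv.Perm.mul_apply, hbD z hz, haD z hz], by rw [Equiv.Perm.mul_apply, hby, hax]⟩

theorem fixOrb_eq_of_mem {D : Finset X} {x y : X} (h : y ∈ fixOrb G D x) :
    fixOrb G D y = fixOrb G D x :=
  (fixOrb_subset_of_mem h).antisymm
    (fixOrb_subset_of_mem (mem_fixOrb_of_mem_of_mem (self_mem_fixOrb D y) h))

theorem card_fixOrb_image {D : Finset X} {a : Equiv.Perm X} (ha : a ∈ G) (x : X) :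
    (fixOrb G D x).card ≤ (fixOrb G (D.image a) (a x)).card := by
  rw [← card_image_of_injective (fixOrb G D x) a.injective]
  refine card_le_card fun y hy => ?_
  obtain ⟨v, hv, rfl⟩ := mem_image.1 hy
  obtain ⟨b, hb, hbD, rfl⟩ := mem_fixOrb.1 hv
  refine mem_fixOrb.2 ⟨a * b * a⁻¹, G.mul_mem (G.mul_mem ha hb) (G.inv_mem ha), fun z hz => ?_,
    by simp⟩
  obtain ⟨w, hw, rfl⟩ := mem_image.1 hz
  simp [hbD w hw]

theorem mem_fixOrb_of_large {D : Finset X} {x y : X}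
    (hx : Fintype.card X < 2 * (fixOrb G D x).card)
    (hy : Fintype.card X < 2 * (fixOrb G D y).card) : y ∈ fixOrb G D x := by
  obtain ⟨v, hv⟩ : (fixOrb G D x ∩ fixOrb G D y).Nonempty := by
    rw [← card_pos]
    have h1 := card_union_add_card_inter (fixOrb G D x) (fixOrb G D y)
    have h2 := card_le_univ (fixOrb G D x ∪ fixOrb G D y)
    omega
  rw [mem_inter] at hv
  exact mem_fixOrb_of_mem_of_mem hv.1 hv.2

/-- A tuple which is generic for large orbits of pointwise stabilisers has all its
permutations realised. -/
theorem exists_realising {ι : Type*} [Fintype ι] [DecidableEq ι] (x : ι → X)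
    (hx : ∀ i, Fintype.card X < 2 * (fixOrb G ((univ.erase i).image x) (x i)).card)
    (π : Equiv.Perm ι) : ∃ g ∈ G, ∀ k, g (x k) = x (π k) := by
  have hswap : ∀ i j, i ≠ j → ∃ g ∈ G, ∀ k, g (x k) = x (Equiv.swap i j k) := by
    intro i j hij
    let D := ((univ.erase i).erase j).image x
    have hDi : (univ.erase i).image x = insert (x j) D := by
      rw [← image_insert, insert_erase (mem_erase.2 ⟨hij.symm, mem_univ j⟩)]
    have hDj : (univ.erase j).image x = insert (x i) D := by
      simp only [D]
      rw [erase_right_comm, ← image_insert, insert_erase (mem_erase.2 ⟨hij, mem_univ i⟩)]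
    have h1 := hx i
    have h2 := hx j
    rw [hDi] at h1
    rw [hDj] at h2
    have h3 : x j ∈ fixOrb G D (x i) := mem_fixOrb_of_large
      (h1.trans_le (Nat.mul_le_mul_left 2 (card_le_card (fixOrb_mono (subset_insert _ _) _))))
      (h2.trans_le (Nat.mul_le_mul_left 2 (card_le_card (fixOrb_mono (subset_insert _ _) _))))
    obtain ⟨a, ha, haD, hai⟩ := mem_fixOrb.1 h3
    have h4 : (insert (x i) D).image a = insert (x j) D := by
      rw [image_insert, hai]
      congr 1
      conv_rhs => rw [← image_id (s := D)]
      exact image_congr fun z hz => haD z hz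
    have h5 := card_fixOrb_image (D := insert (x i) D) ha (x j)
    rw [h4] at h5
    obtain ⟨b, hb, hbD, hbi⟩ := mem_fixOrb.1
      (mem_fixOrb_of_large (h2.trans_le (Nat.mul_le_mul_left 2 h5)) h1)
    refine ⟨b * a, G.mul_mem hb ha, fun k => ?_⟩
    rw [Equiv.Perm.mul_apply]
    by_cases hki : k = i
    · rw [hki, hai, Equiv.swap_apply_left, hbD _ (mem_insert_self _ _)]
    by_cases hkj : k = j
    · rw [hkj, hbi, Equiv.swap_apply_right]
    have hkD : x k ∈ D := mem_image_of_mem _ (mem_erase.2 ⟨hkj, mem_erase.2 ⟨hki, mem_univ _⟩⟩)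
    rw [Equiv.swap_apply_of_ne_of_ne hki hkj, haD _ hkD, hbD _ (mem_insert_of_mem hkD)]
  induction π using Equiv.Perm.swap_induction_on with
  | one => exact ⟨1, G.one_mem, fun _ => rfl⟩
  | swap_mul f i j hij ih =>
    obtain ⟨g, hg, hgx⟩ := ih
    obtain ⟨h, hh, hhx⟩ := hswap i j hij
    exact ⟨h * g, G.mul_mem hh hg, fun k => by
      rw [Equiv.Perm.mul_apply, hgx, hhx, Equiv.Perm.mul_apply]⟩

theorem card_mul_lt_of_update {ι X : Type*} [Fintype X] [Fintype ι] [DecidableEq ι] (i : ι) (d : ℕ)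
    (hX : 0 < Fintype.card X) (bad : (ι → X) → Prop) [DecidablePred bad]
    (h : ∀ f, d * (univ.filter (fun y => bad (Function.update f i y))).card < Fintype.card X) :
    d * (univ.filter bad).card < Fintype.card (ι → X) := by
  have : Nonempty X := Fintype.card_pos_iff.1 hX
  let e := (Equiv.funSplitAt i X).symm
  have he : ∀ (q : {j // j ≠ i} → X) (y z : X), e (y, q) = Function.update (e (z, q)) i y := by
    intro q y z
    ext j
    by_cases hj : j = i
    · subst hj
      simp [e]
    · simp [e, hj]
  have h1 : (univ.filter bad).card
      = ∑ q : {j // j ≠ i} → X, (univ.filter (fun y => bad (e (y, q)))).card := by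
    rw [card_filter, ← Equiv.sum_comp e, Fintype.sum_prod_type, sum_comm]
    simp_rw [card_filter]
  have h2 : Fintype.card (ι → X) = ∑ q : {j // j ≠ i} → X, Fintype.card X := by
    rw [Fintype.card_congr e.symm, Fintype.card_prod, mul_comm]
    simp
  rw [h1, h2, mul_sum]
  refine sum_lt_sum_of_nonempty univ_nonempty fun q _ => ?_
  obtain ⟨z⟩ := this
  have h3 := h (e (z, q))
  simp_rw [← he] at h3
  exact h3

/-- If all small pointwise stabilisers have a huge orbit, then every permutation of a small set
is induced on a tuple of points. -/
theorem exists_tuple {ι : Type*} [Fintype ι] [DecidableEq ι] (d : ℕ)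
    (hd : 2 ≤ d) (hι : Fintype.card ι ≤ d) (hX2 : 2 ≤ Fintype.card X)
    (hD : ∀ D : Finset X, D.card ≤ Fintype.card ι →
      ∃ x, d * (Fintype.card X - (fixOrb G D x).card) < Fintype.card X) :
    ∃ x : ι → X, Function.Injective x ∧
      ∀ π : Equiv.Perm ι, ∃ g ∈ G, ∀ k, g (x k) = x (π k) := by
  classical
  have hX : 0 < Fintype.card X := by omega
  have hD' : ∀ (f : ι → X) (i : ι), ∃ x, d * (Fintype.card X -
      (fixOrb G ((univ.erase i).image f) x).card) < Fintype.card X := fun f i => by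
    refine hD _ (card_image_le.trans ?_)
    exact card_le_univ _
  suffices ∃ x : ι → X, ∀ i,
      Fintype.card X < 2 * (fixOrb G ((univ.erase i).image x) (x i)).card by
    obtain ⟨x, hx⟩ := this
    refine ⟨x, fun i j hij => ?_, exists_realising x hx⟩
    by_contra hne
    have h1 : fixOrb G ((univ.erase i).image x) (x i) ⊆ {x i} := by
      intro v hv
      obtain ⟨a, -, haD, rfl⟩ := mem_fixOrb.1 hv
      rw [mem_singleton]
      exact haD _ (mem_image.2 ⟨j, mem_erase.2 ⟨fun h => hne h.symm, mem_univ j⟩, hij.symm⟩)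
    have h2 := card_le_card h1
    rw [card_singleton] at h2
    have h3 := hx i
    omega
  by_contra! hcon
  let bad : ι → (ι → X) → Prop := fun i f =>
    2 * (fixOrb G ((univ.erase i).image f) (f i)).card ≤ Fintype.card X
  have h1 : ∀ i, d * (univ.filter (bad i)).card < Fintype.card (ι → X) := by
    intro i
    refine card_mul_lt_of_update i d hX (bad i) fun f => ?_
    have e : ∀ y, (univ.erase i).image (Function.update f i y) = (univ.erase i).image f :=
      fun y => image_congr fun j hj => by
        simp only [coe_erase, coe_univ, Set.mem_sdiff, Set.mem_univ, true_and,
          Set.mem_singleton_iff] at hj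
        simp [hj]
    simp only [bad, e, Function.update_self]
    obtain ⟨x, hx⟩ := hD' f i
    refine lt_of_le_of_lt (Nat.mul_le_mul_left d ?_) hx
    rw [← card_compl]
    refine card_le_card fun y hy => ?_
    rw [mem_compl]
    intro hyx
    have h2 := (mem_filter.1 hy).2
    rw [fixOrb_eq_of_mem hyx] at h2
    have h3 : 2 * (Fintype.card X - (fixOrb G ((univ.erase i).image f) x).card)
        ≤ d * (Fintype.card X - (fixOrb G ((univ.erase i).image f) x).card) :=
      Nat.mul_le_mul_right _ hd
    omega
  have h2 : Fintype.card (ι → X) ≤ ∑ i, (univ.filter (bad i)).card := by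
    rw [← card_univ]
    refine le_trans (card_le_card fun f _ => ?_) card_biUnion_le
    obtain ⟨i, hi⟩ := hcon f
    exact mem_biUnion.2 ⟨i, mem_univ i, mem_filter.2 ⟨mem_univ f, hi⟩⟩
  have : Nonempty X := Fintype.card_pos_iff.1 hX
  have h0 : 0 < Fintype.card (ι → X) := Fintype.card_pos
  have hne : (univ : Finset ι).Nonempty := by
    obtain ⟨i, -⟩ := hcon (fun _ => Classical.arbitrary X)
    exact ⟨i, mem_univ i⟩
  have h3 : ∑ i, d * (univ.filter (bad i)).card < ∑ _i : ι, Fintype.card (ι → X) :=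
    sum_lt_sum_of_nonempty hne fun i _ => h1 i
  rw [← mul_sum, sum_const, card_univ, smul_eq_mul] at h3
  have h4 : Fintype.card ι * Fintype.card (ι → X) ≤ d * ∑ i, (univ.filter (bad i)).card :=
    Nat.mul_le_mul hι h2
  omega

/-- A doubly transitive group whose pointwise stabiliser of a small set has no huge orbit has a
small base. -/
theorem card_elems_le_of_separating (h2 : TwoTrans G) {L d : ℕ} (hn : Fintype.card X ≤ 2 ^ L)
    (hd : 1 ≤ d) (D : Finset X)
    (hD : ∀ x, Fintype.card X ≤ d * (Fintype.card X - (fixOrb G D x).card)) :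
    (elems G).card ≤ Fintype.card X ^ (D.card * (d * (2 * L + 1))) := by
  classical
  let B : Finset (X × X) := univ.filter (fun p => p.2 ∉ fixOrb G D p.1)
  have hBd : ∀ p ∈ B, p.1 ≠ p.2 := by
    intro p hp h
    have := (mem_filter.1 hp).2
    rw [← h] at this
    exact this (self_mem_fixOrb D p.1)
  have hBc : Fintype.card X * Fintype.card X ≤ d * B.card := by
    have e : B.card = ∑ x, (Fintype.card X - (fixOrb G D x).card) := by
      simp only [B]
      rw [card_filter, Fintype.sum_prod_type]
      refine sum_congr rfl fun x _ => ?_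
      rw [← card_filter, ← card_compl]
      congr 1
      ext y
      simp
    rw [e, mul_sum]
    calc Fintype.card X * Fintype.card X = ∑ _x : X, Fintype.card X := by simp
      _ ≤ _ := sum_le_sum fun x _ => hD x
  let P : X × X → Finset (elems G) := fun p =>
    univ.filter (fun g => (g.1 p.1, g.1 p.2) ∈ B)
  have hP : ∀ p ∈ (univ : Finset X).offDiag, Fintype.card (elems G) ≤ d * (P p).card := by
    intro p hp
    have hpp : p.1 ≠ p.2 := by simpa using hp
    have h3 := sum_card_filter_map₂ h2 {p} B (by simpa using hpp) hBd
    have e : ∑ g ∈ elems G, (({p} : Finset (X × X)).filter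
        (fun p => (g p.1, g p.2) ∈ B)).card = (P p).card := by
      simp only [P]
      rw [card_filter, ← sum_coe_sort (elems G)]
      refine sum_congr rfl fun g _ => ?_
      rw [card_filter, sum_singleton]
    rw [e, card_singleton, one_mul] at h3
    rw [Fintype.card_coe]
    have h4 : 0 < (univ : Finset X).offDiag.card := card_pos.2 ⟨p, hp⟩
    refine le_of_mul_le_mul_left ?_ h4
    calc (univ : Finset X).offDiag.card * (elems G).card
        ≤ (Fintype.card X * Fintype.card X) * (elems G).card := by
          gcongr
          rw [offDiag_card, card_univ]
          exact Nat.sub_le _ _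
      _ ≤ (d * B.card) * (elems G).card := by gcongr
      _ = d * (B.card * (elems G).card) := by ring
      _ = d * ((univ : Finset X).offDiag.card * (P p).card) := by rw [h3]
      _ = _ := by ring
  have hcov := card_uncovered_mul_le (univ : Finset X).offDiag P d (2 * L + 1) hd hP
  obtain ⟨f, hf⟩ : ∃ f : Fin (d * (2 * L + 1)) → elems G,
      ∀ p ∈ (univ : Finset X).offDiag, ∃ k, f k ∈ P p := by
    by_contra! hcon
    rw [filter_true_of_mem (fun f _ => hcon f), card_univ, Fintype.card_fun,
      Fintype.card_fin] at hcov
    have h0 : 0 < Fintype.card (elems G) := by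
      rw [Fintype.card_coe]
      exact elems_card_pos G
    have h3 : 0 < Fintype.card (elems G) ^ (d * (2 * L + 1)) := by positivity
    have h4 : (univ : Finset X).offDiag.card ≤ 2 ^ (2 * L) := by
      rw [offDiag_card, card_univ, mul_comm 2 L, pow_mul, sq]
      exact (Nat.sub_le _ _).trans (Nat.mul_le_mul hn hn)
    have h5 : 0 < 2 ^ (2 * L) := by positivity
    rw [mul_comm] at hcov
    have h6 := le_of_mul_le_mul_right hcov h3
    rw [pow_succ] at h6
    omega
  let base : Fin (d * (2 * L + 1)) × D → X := fun k => (f k.1).1⁻¹ k.2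
  have hbase : ∀ a ∈ G, (∀ k, a (base k) = base k) → a = 1 := by
    intro a ha hfix
    by_contra h1
    obtain ⟨x, hx⟩ : ∃ x, a x ≠ x := by
      by_contra! h
      exact h1 (Equiv.ext h)
    obtain ⟨k, hk⟩ := hf (x, a x) (by simpa using hx.symm)
    have h3 : (f k).1 (a x) ∉ fixOrb G D ((f k).1 x) :=
      (mem_filter.1 (mem_filter.1 hk).2).2
    have hfG : (f k).1 ∈ G := mem_elems.1 (f k).2
    refine h3 (mem_fixOrb.2 ⟨(f k).1 * a * (f k).1⁻¹,
      G.mul_mem (G.mul_mem hfG ha) (G.inv_mem hfG), fun z hz => ?_, by simp⟩)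
    have h4 : a ((f k).1⁻¹ z) = (f k).1⁻¹ z := hfix (k, ⟨z, hz⟩)
    rw [Equiv.Perm.mul_apply, Equiv.Perm.mul_apply, h4]
    simp
  have hcard : Fintype.card (Fin (d * (2 * L + 1)) × D) = D.card * (d * (2 * L + 1)) := by
    rw [Fintype.card_prod, Fintype.card_fin, Fintype.card_coe, mul_comm]
  rw [← hcard, ← Fintype.card_fun, ← card_univ]
  refine card_le_card_of_injOn (fun a k => a (base k)) (fun _ _ => by simp) ?_
  intro a ha b hb hab
  simp only [mem_coe, mem_elems] at ha hb
  have := hbase (b⁻¹ * a) (G.mul_mem (G.inv_mem hb) ha) fun k => by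
    rw [Equiv.Perm.mul_apply, Equiv.Perm.inv_eq_iff_eq]
    exact congrFun hab k
  exact (inv_mul_eq_one.1 this).symm

end PointwiseOrbits

section Primes

theorem five_mul_lt_card_primes {L : ℕ} (hL : 64 ≤ L) : 5 * L < (L ^ 3).primesLE.card := by
  rw [Nat.primesLE_card_eq_primeCounting]
  have h := Chebyshev.pi_ge (L ^ 3)
  have hL' : (64 : ℝ) ≤ L := by exact_mod_cast hL
  have h1 : Real.log ((L ^ 3 : ℕ) : ℝ) ≤ 3 * L := by
    push_cast
    rw [Real.log_pow]
    have := Real.log_le_sub_one_of_pos (show (0 : ℝ) < L by linarith)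
    push_cast
    linarith
  have h2 : Real.log ((L ^ 3 : ℕ) + 1) ≤ 4 * L := by
    push_cast
    calc Real.log ((L : ℝ) ^ 3 + 1) ≤ Real.log ((L : ℝ) ^ 4) := by
          apply Real.log_le_log (by positivity)
          have : (1 : ℝ) ≤ (L : ℝ) ^ 3 := one_le_pow₀ (by linarith)
          nlinarith
      _ = 4 * Real.log L := by rw [Real.log_pow]; push_cast; ring
      _ ≤ 4 * L := by
          have := Real.log_le_sub_one_of_pos (show (0 : ℝ) < L by linarith)
          linarith
  have h0 : 0 < Real.log ((L ^ 3 : ℕ) : ℝ) := by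
    apply Real.log_pos
    push_cast
    exact one_lt_pow₀ (by linarith) (by norm_num)
  rw [div_le_iff₀ h0] at h
  have h3 : (1 / 2 : ℝ) ≤ Real.log 2 := by
    have := Real.log_two_gt_d9
    linarith
  by_contra! hcon
  have hcon' : ((Nat.primeCounting (L ^ 3) : ℕ) : ℝ) ≤ 5 * L := by exact_mod_cast hcon
  have h4 : ((Nat.primeCounting (L ^ 3) : ℕ) : ℝ) * Real.log ((L ^ 3 : ℕ) : ℝ)
      ≤ (5 * L) * (3 * L) := mul_le_mul hcon' h1 h0.le (by linarith)
  have h5 : ((L ^ 3 : ℕ) : ℝ) * (1 / 2) ≤ ((L ^ 3 : ℕ) : ℝ) * Real.log 2 := by gcongr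
  push_cast at h h2 h4 h5
  have h6 : (64 : ℝ) * (L * L) ≤ L * (L * L) := by gcongr
  nlinarith

theorem minimalPeriod_le_card {X : Type*} [Fintype X] (g : Equiv.Perm X) (y : X) :
    Function.minimalPeriod g y ≤ Fintype.card X := by
  have h : Set.InjOn (fun k => g^[k] y) (range (Function.minimalPeriod g y)) := by
    have := Function.iterate_injOn_Iio_minimalPeriod (f := g) (x := y)
    rwa [← coe_Iio, Nat.Iio_eq_range] at this
  have := card_le_card_of_injOn (t := univ) _ (fun k _ => mem_univ _) h
  rwa [card_range, card_univ] at this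

theorem minimalPeriod_pos {X : Type*} [Finite X] (g : Equiv.Perm X) (y : X) :
    0 < Function.minimalPeriod g y :=
  Function.minimalPeriod_pos_of_mem_periodicPts
    (Function.Injective.mem_periodicPts g.injective y)

theorem minimalPeriod_dvd_iff {X : Type*} (g : Equiv.Perm X) (y : X) (k : ℕ) :
    Function.minimalPeriod g y ∣ k ↔ (g ^ k) y = y := by
  rw [← Function.isPeriodicPt_iff_minimalPeriod_dvd, Function.IsPeriodicPt, Function.IsFixedPt,
    Equiv.Perm.iterate_eq_pow]

theorem dvd_orderOf_of_realises {X : Type*} {P : Finset ℕ} (x : (Σ p : P, Fin p.1) → X)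
    (hx : Function.Injective x) (g : Equiv.Perm X)
    (hg : ∀ k, g (x k) = x (Equiv.sigmaCongrRight (fun p : P => finRotate p.1) k)) (p : ℕ)
    (hp : p ∈ P) (hp2 : 2 ≤ p) : p ∣ orderOf g := by
  have h1 : ∀ m (a : Fin p), (g ^ m) (x ⟨⟨p, hp⟩, a⟩) = x ⟨⟨p, hp⟩, (finRotate p ^ m) a⟩ := by
    intro m
    induction m with
    | zero => intro a; rfl
    | succ m ih =>
      intro a
      rw [pow_succ', Equiv.Perm.mul_apply, ih, hg, pow_succ', Equiv.Perm.mul_apply]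
      rfl
  have h2 : orderOf (finRotate p) = p := by
    rw [(isCycle_finRotate_of_le hp2).orderOf, support_finRotate_of_le hp2, card_univ,
      Fintype.card_fin]
  rw [← h2]
  refine orderOf_dvd_of_pow_eq_one (Equiv.ext fun a => ?_)
  have h3 := h1 (orderOf g) a
  rw [pow_orderOf_eq_one, Equiv.Perm.one_apply] at h3
  have h4 := hx h3
  simp only [Sigma.mk.injEq, heq_eq_eq, true_and] at h4
  rw [Equiv.Perm.one_apply]
  simpa [h2] using h4.symm

variable {X : Type*} [Fintype X] [DecidableEq X]

/-- A permutation whose order has many prime divisors has a nontrivial power with small support. -/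
theorem exists_pow_small_support (g : Equiv.Perm X) {L : ℕ} (hn : Fintype.card X ≤ 2 ^ L)
    (hX : 0 < Fintype.card X) (P : Finset ℕ) (hP : ∀ p ∈ P, p.Prime) (hPg : ∀ p ∈ P, p ∣ orderOf g)
    (hPc : 5 * L < P.card) : ∃ k, g ^ k ≠ 1 ∧ 5 * (g ^ k).support.card ≤ Fintype.card X := by
  have h1 : ∀ y, (P.filter (fun p => p ∣ Function.minimalPeriod g y)).card ≤ L := by
    intro y
    obtain ⟨Q, hQ⟩ : ∃ Q, Q = P.filter (fun p => p ∣ Function.minimalPeriod g y) := ⟨_, rfl⟩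
    rw [← hQ]
    have hQp : ∀ p ∈ Q, p.Prime ∧ p ∣ Function.minimalPeriod g y := fun p hp => by
      rw [hQ, mem_filter] at hp
      exact ⟨hP p hp.1, hp.2⟩
    refine (Nat.pow_le_pow_iff_right (a := 2) (by norm_num)).1 ?_
    calc 2 ^ Q.card ≤ ∏ p ∈ Q, p := pow_card_le_prod _ _ _ fun p hp => (hQp p hp).1.two_le
      _ ≤ Function.minimalPeriod g y := Nat.le_of_dvd (minimalPeriod_pos g y)
          (prod_primes_dvd _ (fun p hp => (hQp p hp).1.prime) fun p hp => (hQp p hp).2)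
      _ ≤ _ := (minimalPeriod_le_card g y).trans hn
  obtain ⟨p, hp, hps⟩ : ∃ p ∈ P,
      5 * (univ.filter (fun y => p ∣ Function.minimalPeriod g y)).card ≤ Fintype.card X := by
    by_contra! hcon
    have h2 : P.card * Fintype.card X
        ≤ ∑ p ∈ P, 5 * (univ.filter (fun y => p ∣ Function.minimalPeriod g y)).card := by
      rw [← smul_eq_mul]
      exact card_nsmul_le_sum _ _ _ fun p hp => (hcon p hp).le
    have h3 : ∑ p ∈ P, (univ.filter (fun y => p ∣ Function.minimalPeriod g y)).card
        ≤ Fintype.card X * L := by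
      have e : ∑ p ∈ P, (univ.filter (fun y => p ∣ Function.minimalPeriod g y)).card
          = ∑ y, (P.filter (fun p => p ∣ Function.minimalPeriod g y)).card := by
        simp_rw [card_filter]
        rw [sum_comm]
      rw [e]
      exact (sum_le_card_nsmul _ _ _ fun y _ => h1 y).trans (by simp)
    rw [← mul_sum] at h2
    have h4 : 5 * L * Fintype.card X < P.card * Fintype.card X := Nat.mul_lt_mul_of_pos_right hPc hX
    nlinarith
  have hN : orderOf g ≠ 0 := (orderOf_pos g).ne'
  refine ⟨orderOf g / p ^ (orderOf g).factorization p, fun h => ?_, ?_⟩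
  · have h2 := (hPg p hp).trans (orderOf_dvd_of_pow_eq_one h)
    exact Nat.not_dvd_ordCompl (hP p hp) hN h2
  · refine le_trans (Nat.mul_le_mul_left 5 (card_le_card fun y hy => ?_)) hps
    rw [mem_filter]
    refine ⟨mem_univ y, ?_⟩
    by_contra hy'
    rw [Equiv.Perm.mem_support] at hy
    apply hy
    rw [← minimalPeriod_dvd_iff]
    have h2 : Function.minimalPeriod g y ∣ orderOf g := by
      rw [minimalPeriod_dvd_iff, pow_orderOf_eq_one, Equiv.Perm.one_apply]
    rw [← Nat.ordProj_mul_ordCompl_eq_self (orderOf g) p] at h2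
    exact (Nat.Coprime.pow_right _ (((hP p hp).coprime_iff_not_dvd.2 hy').symm)).dvd_of_dvd_mul_left h2

variable {G : Subgroup (Equiv.Perm X)}

theorem card_elems_le_of_twoTrans (hG : IsPrimitiveSubgroup G) (h2 : TwoTrans G)
    (hA : ¬ alternatingGroup X ≤ G) {L : ℕ} (hL : 64 ≤ L) (hn : Fintype.card X ≤ 2 ^ L)
    (hn' : 81 < Fintype.card X) :
    (elems G).card ≤ Fintype.card X ^ (L ^ 6 * ((L ^ 6 + 1) * (2 * L + 1))) := by
  obtain ⟨D, hDc, hD⟩ : ∃ D : Finset X, D.card ≤ L ^ 6 ∧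
      ∀ x, Fintype.card X ≤ (L ^ 6 + 1) * (Fintype.card X - (fixOrb G D x).card) := by
    by_contra! hcon
    have hP : ∀ p ∈ (L ^ 3).primesLE, p.Prime ∧ p ≤ L ^ 3 := fun p hp =>
      ⟨Nat.prime_of_mem_primesLE hp, Nat.le_of_mem_primesLE hp⟩
    have hι : Fintype.card (Σ p : (L ^ 3).primesLE, Fin p.1) ≤ L ^ 6 := by
      rw [Fintype.card_sigma]
      simp_rw [Fintype.card_fin]
      refine (sum_le_card_nsmul _ _ (L ^ 3) fun p _ => (hP p.1 p.2).2).trans ?_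
      have h1 : (L ^ 3).primesLE.card ≤ L ^ 3 := by
        have : (L ^ 3).primesLE ⊆ Icc 1 (L ^ 3) := fun p hp =>
          mem_Icc.2 ⟨(hP p hp).1.one_le, (hP p hp).2⟩
        simpa using card_le_card this
      rw [card_univ, Fintype.card_coe, smul_eq_mul]
      calc _ ≤ L ^ 3 * L ^ 3 := Nat.mul_le_mul_right _ h1
        _ = L ^ 6 := by ring
    have hL6 : 1 ≤ L ^ 6 := Nat.one_le_pow _ _ (by omega)
    obtain ⟨x, hx, hreal⟩ := exists_tuple (G := G) (ι := Σ p : (L ^ 3).primesLE, Fin p.1)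
      (L ^ 6 + 1) (by omega) (by omega) (by omega) (fun D hD => hcon D (hD.trans hι))
    obtain ⟨g, hg, hgx⟩ := hreal (Equiv.sigmaCongrRight fun p => finRotate p.1)
    obtain ⟨k, hk1, hk⟩ := exists_pow_small_support g hn (by omega) (L ^ 3).primesLE
      (fun p hp => (hP p hp).1)
      (fun p hp => dvd_orderOf_of_realises x hx g hgx p hp (hP p hp).1.two_le)
      (five_mul_lt_card_primes hL)
    have := lt_five_mul_card_support hG h2 hA hn' (G.pow_mem hg k) hk1
    omega
  refine (card_elems_le_of_separating h2 hn (by omega) D hD).trans ?_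
  exact Nat.pow_le_pow_right (by omega) (Nat.mul_le_mul_right _ hDc)

/-- A doubly transitive group not containing the alternating group is thin. -/
theorem thin_of_twoTrans (hG : IsPrimitiveSubgroup G) (h2 : TwoTrans G)
    (hA : ¬ alternatingGroup X ≤ G) {L : ℕ} (hL : 64 ≤ L) (hn : Fintype.card X ≤ 2 ^ L)
    (hn' : L ^ 100 ≤ Fintype.card X) : Thin G (L ^ 20) := by
  have hn81 : 81 < Fintype.card X := by
    calc 81 < 64 ^ 2 := by norm_num
      _ ≤ L ^ 2 := by gcongr
      _ ≤ L ^ 100 := Nat.pow_le_pow_right (by omega) (by omega)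
      _ ≤ _ := hn'
  intro σ
  rcases le_or_gt (5 * σ) (Fintype.card X) with hσ | hσ
  · refine (card_le_one.2 fun a ha b hb => ?_).trans Nat.one_le_two_pow
    have key : ∀ a ∈ (elems G).filter (fun a => a.support.card ≤ σ), a = 1 := by
      intro a ha
      by_contra h1
      have h3 := lt_five_mul_card_support hG h2 hA hn81 (mem_elems.1 (mem_filter.1 ha).1) h1
      have h4 := (mem_filter.1 ha).2
      omega
    rw [key a ha, key b hb]
  · refine (card_le_card (filter_subset _ _)).trans
      ((card_elems_le_of_twoTrans hG h2 hA hL hn hn81).trans ?_)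
    calc _ ≤ (2 ^ L) ^ (L ^ 6 * ((L ^ 6 + 1) * (2 * L + 1))) := by gcongr
      _ = 2 ^ (L * (L ^ 6 * ((L ^ 6 + 1) * (2 * L + 1)))) := (pow_mul 2 L _).symm
      _ ≤ _ := by
        apply Nat.pow_le_pow_right (by omega)
        rw [Nat.le_div_iff_mul_le (by positivity)]
        have h3 : 5 * (L * (L ^ 6 * ((L ^ 6 + 1) * (2 * L + 1))) * L ^ 20) < 5 * σ := by
          calc 5 * (L * (L ^ 6 * ((L ^ 6 + 1) * (2 * L + 1))) * L ^ 20)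
              ≤ L * (L * (L ^ 6 * ((L ^ 6 + L ^ 6) * (2 * L + L))) * L ^ 20) := by
                gcongr
                · omega
                · exact Nat.one_le_pow _ _ (by omega)
                · omega
            _ = 6 * L ^ 35 := by ring
            _ ≤ L * L ^ 35 := by gcongr; omega
            _ = L ^ 36 := by ring
            _ ≤ L ^ 100 := Nat.pow_le_pow_right (by omega) (by omega)
            _ ≤ _ := hn'
            _ < _ := hσ
        omega

end Primes

section Scale

theorem exists_log_scale :
    ∃ n₀ : ℕ, ∀ n, n₀ ≤ n → ∃ L : ℕ, 10 ^ 9 ≤ L ∧ n ≤ 2 ^ L ∧ L ^ 100 ≤ n := by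
  obtain ⟨L₀, hL₀⟩ : ∃ L₀ : ℕ, ∀ L, L₀ ≤ L → 2 * L ^ 100 ≤ 2 ^ L := by
    have h := (tendsto_pow_const_div_const_pow_of_one_lt 100
      (show (1 : ℝ) < 2 by norm_num)).eventually_lt_const (show (0 : ℝ) < 1 / 2 by norm_num)
    obtain ⟨L₀, h⟩ := Filter.eventually_atTop.1 h
    refine ⟨L₀, fun L hL => ?_⟩
    have h1 := h L hL
    rw [div_lt_iff₀ (by positivity)] at h1
    have h2 : (2 : ℝ) * (L : ℝ) ^ 100 ≤ 2 ^ L := by linarith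
    exact_mod_cast h2
  obtain ⟨M, hM, hM'⟩ : ∃ M : ℕ, L₀ ≤ M ∧ 10 ^ 9 ≤ M :=
    ⟨max L₀ (10 ^ 9), le_max_left _ _, le_max_right _ _⟩
  refine ⟨2 ^ M + 1, fun n hn => ⟨Nat.clog 2 n, ?_⟩⟩
  have hML : M < Nat.clog 2 n := (Nat.lt_clog_iff_pow_lt one_lt_two).2 hn
  have hn1 : 1 < n := by
    have := Nat.one_le_two_pow (n := M)
    omega
  refine ⟨by omega, Nat.le_pow_clog one_lt_two n, ?_⟩
  have h1 := hL₀ (Nat.clog 2 n) (by omega)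
  have h2 := Nat.pow_pred_clog_lt_self one_lt_two hn1
  obtain ⟨l, hl⟩ : ∃ l, Nat.clog 2 n = l + 1 := ⟨Nat.clog 2 n - 1, by omega⟩
  rw [hl] at h1 h2 ⊢
  rw [Nat.pred_succ] at h2
  rw [pow_succ 2 l] at h1
  omega

/-- A group containing the alternating group is alternating or symmetric. -/
theorem eq_top_of_alternatingGroup_le {X : Type*} [Fintype X] [DecidableEq X] [Nontrivial X]
    {G : Subgroup (Equiv.Perm X)} (hA : alternatingGroup X ≤ G) (hG : G ≠ alternatingGroup X) :
    G = ⊤ := by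
  have h := Subgroup.index_dvd_of_le hA
  rw [alternatingGroup.index_eq_two] at h
  rcases (Nat.dvd_prime Nat.prime_two).1 h with h | h
  · exact Subgroup.index_eq_one.1 h
  · exact absurd (Equiv.Perm.eq_alternatingGroup_of_index_eq_two h) hG

end Scale

end PrimitiveAut

theorem most_primitive_groups_are_full_automorphism_groups :
    ∃ n₀ : ℕ, ∀ (X : Type) [Fintype X] [DecidableEq X],
      n₀ ≤ Fintype.card X →
      ∀ G : Subgroup (Equiv.Perm X), IsPrimitiveSubgroup G →
        G ≠ alternatingGroup X →
        ∃ k : ℕ, k ≤ Fintype.card X ∧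
          ∃ ℬ : Set (Set X), ℬ.Nonempty ∧ (∀ B ∈ ℬ, B.ncard = k) ∧
            (∀ σ : Equiv.Perm X, ((fun Y : Set X => (σ : X → X) '' Y) '' ℬ = ℬ) ↔ σ ∈ G) ∧
            (∀ B₁ ∈ ℬ, ∀ B₂ ∈ ℬ, ∃ g ∈ G, (g : X → X) '' B₁ = B₂) := by
  obtain ⟨n₀, hn₀⟩ := PrimitiveAut.exists_log_scale
  refine ⟨n₀, fun X _ _ hX G hG hGA => ?_⟩
  obtain ⟨L, hL, hn, hn'⟩ := hn₀ _ hX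
  have hL64 : 64 ≤ L := le_trans (by norm_num) hL
  by_cases hA : alternatingGroup X ≤ G
  · have : Nontrivial X := by
      rw [← Fintype.one_lt_card_iff_nontrivial]
      calc 1 < L := by omega
        _ ≤ L ^ 100 := Nat.le_self_pow (by norm_num) L
        _ ≤ _ := hn'
    rw [PrimitiveAut.eq_top_of_alternatingGroup_le hA hGA]
    exact ⟨0, Nat.zero_le _, {∅}, by simp, by simp, by simp, by simp⟩
  · have hT : PrimitiveAut.Thin G (L ^ 20) := by
      by_cases h2 : PrimitiveAut.TwoTrans G
      · exact PrimitiveAut.thin_of_twoTrans hG h2 hA hL64 hn hn'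
      · exact PrimitiveAut.thin_of_not_twoTrans hG h2 hL64 hn hn'
    obtain ⟨Y, hY⟩ := PrimitiveAut.exists_good_set hL hG.transitive hn
      ((Nat.pow_le_pow_right (by omega) (by norm_num)).trans hn') hT
    exact PrimitiveAut.exists_family_of_good hY
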